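/- For a von Neumann factor M acting on a separable Hilbert space H with a separating and cyclic vector x0, the following are equivalent: (i) for every normal completely bounded map φ : M → M, the map φ̃ extends to a normal completely bounded map on B(H); (ii) for every normal completely bounded map φ : M → M, the map φ̃ extends to a normal map on B(H); (iii) M is of type I. -/

import Mathlib

set_option synthInstance.maxHeartbeats 1000000
set_option maxHeartbeats 1000000

noncomputable section

open scoped InnerProductSpace ComplexOrder
open ContinuousLinearMap

local notation "⟪" x ", " y "⟫" => @inner ℂ _ _ x y

namespace ChoiInf

variable {H : Type*} [NormedAddCommGroup H] [InnerProductSpace ℂ H] [CompleteSpace H]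

/-- The rank one operator `x ⊠ y : z ↦ (z|y)·x = ⟪y, z⟫ • x`
(inner products written with Mathlib's convention: conjugate linear in the
first variable, so that the paper's `(z|y)` is `⟪y, z⟫`). -/
def rankOne (x y : H) : H →L[ℂ] H := (innerSL ℂ y).smulRight x

/-- The trace of an operator, computed relative to a Hilbert basis:
`Tr X = Σᵢ (X eᵢ | eᵢ) = Σᵢ ⟪eᵢ, X eᵢ⟫`.  (For trace class operators this does
not depend on the choice of basis.) -/
def tr {ι : Type*} (b : HilbertBasis ι ℂ H) (T : H →L[ℂ] H) : ℂ :=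
  ∑' i, ⟪b i, T (b i)⟫

/-- The bilinear pairing `⟨A, B⟩ = Tr (A B)` between `B(H)` and `T(H)`. -/
def pairing {ι : Type*} (b : HilbertBasis ι ℂ H) (A T : H →L[ℂ] H) : ℂ :=
  tr b (A ∘L T)

/-- Trace class operators, characterized by nuclear representations
`T = Σₙ xₙ ⊠ yₙ` with `Σₙ ‖xₙ‖‖yₙ‖ < ∞`. -/
def IsTraceClass (T : H →L[ℂ] H) : Prop :=
  ∃ x y : ℕ → H, Summable (fun n => ‖x n‖ * ‖y n‖) ∧
    ∀ z, T z = ∑' n, ⟪y n, z⟫ • x n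

/-- The trace norm, as the infimum of `Σₙ ‖xₙ‖‖yₙ‖` over all nuclear
representations `T = Σₙ xₙ ⊠ yₙ`. -/
def traceNorm (T : H →L[ℂ] H) : ℝ :=
  sInf {c : ℝ | ∃ x y : ℕ → H, HasSum (fun n => ‖x n‖ * ‖y n‖) c ∧
    ∀ z, T z = ∑' n, ⟪y n, z⟫ • x n}

/-- `(Φ, Φst)` is a dual pair:  `Φst` preserves the trace class and
`⟨Φ A, T⟩ = ⟨A, Φst T⟩` for all trace class `T`.  A linear map `Φ` on `B(H)` is
normal (σ-weakly continuous) precisely when it admits such a predual map `Φst`. -/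
def IsNormalPair {ι : Type*} (b : HilbertBasis ι ℂ H)
    (Φ Φst : (H →L[ℂ] H) →ₗ[ℂ] (H →L[ℂ] H)) : Prop :=
  (∀ T, IsTraceClass T → IsTraceClass (Φst T)) ∧
    ∀ A T, IsTraceClass T → pairing b (Φ A) T = pairing b A (Φst T)

/-- Positivity of a `k × k` matrix of operators, i.e. positivity of the
corresponding operator on `H ⊕ ⋯ ⊕ H`. -/
def MatPos {k : ℕ} (A : Fin k → Fin k → (H →L[ℂ] H)) : Prop :=
  ∀ v : Fin k → H, 0 ≤ ∑ i, ∑ j, ⟪v i, A i j (v j)⟫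

/-- The operator on `H ⊕ ⋯ ⊕ H` given by a `k × k` matrix of operators has norm `≤ c`. -/
def matNormLe {k : ℕ} (A : Fin k → Fin k → (H →L[ℂ] H)) (c : ℝ) : Prop :=
  ∀ v w : Fin k → H,
    ‖∑ i, ∑ j, ⟪w i, A i j (v j)⟫‖ ≤
      c * Real.sqrt (∑ i, ‖v i‖ ^ 2) * Real.sqrt (∑ i, ‖w i‖ ^ 2)

/-- A von Neumann algebra is a factor when its center consists of the scalars. -/
def IsFactor (M : VonNeumannAlgebra H) : Prop :=
  ∀ T ∈ M, T ∈ M.commutant → ∃ c : ℂ, T = c • (1 : H →L[ℂ] H)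

/-- `x0` is a cyclic vector for `M`. -/
def Cyclic (M : VonNeumannAlgebra H) (x0 : H) : Prop :=
  Dense {y : H | ∃ A ∈ M, A x0 = y}

/-- `x0` is a separating vector for `M`. -/
def Separating (M : VonNeumannAlgebra H) (x0 : H) : Prop :=
  ∀ A ∈ M, A x0 = 0 → A = 0

/-- `Φ` restricts on `alg(M', M)` to the map `φ̃ : A'B ↦ A'·φ(B)`.
(Maps `φ : M → M` are encoded as linear maps on `B(H)` sending `M` into `M`;
only the restriction to `M` is relevant.) -/
def ExtendsTilde (M : VonNeumannAlgebra H)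
    (φ Φ : (H →L[ℂ] H) →ₗ[ℂ] (H →L[ℂ] H)) : Prop :=
  ∀ A' ∈ M.commutant, ∀ B ∈ M, Φ (A' * B) = A' * φ B

/-- The space `CB^σ_ε(M)` of maps `φ : M → M` such that `φ̃` extends to a normal
map on `B(H)`. -/
def CBSigmaE {ι : Type*} (b : HilbertBasis ι ℂ H) (M : VonNeumannAlgebra H) :
    Set ((H →L[ℂ] H) →ₗ[ℂ] (H →L[ℂ] H)) :=
  {φ | (∀ B ∈ M, φ B ∈ M) ∧
    ∃ Φ Φst, ExtendsTilde M φ Φ ∧ IsNormalPair b Φ Φst}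

/-- `φ` is completely positive as a map on `M`. -/
def IsCPOn (M : VonNeumannAlgebra H) (φ : (H →L[ℂ] H) →ₗ[ℂ] (H →L[ℂ] H)) : Prop :=
  ∀ (k : ℕ) (A : Fin k → Fin k → (H →L[ℂ] H)), (∀ i j, A i j ∈ M) →
    MatPos A → MatPos fun i j => φ (A i j)

/-- `φ` is completely positive (on all of `B(H)`). -/
def IsCPFull (φ : (H →L[ℂ] H) →ₗ[ℂ] (H →L[ℂ] H)) : Prop :=
  ∀ (k : ℕ) (A : Fin k → Fin k → (H →L[ℂ] H)), MatPos A → MatPos fun i j => φ (A i j)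

/-- `c` is a completely bounded bound for `φ` as a map on `M`. -/
def CBBoundOn (M : VonNeumannAlgebra H) (φ : (H →L[ℂ] H) →ₗ[ℂ] (H →L[ℂ] H))
    (c : ℝ) : Prop :=
  ∀ (k : ℕ) (A : Fin k → Fin k → (H →L[ℂ] H)), (∀ i j, A i j ∈ M) →
    matNormLe A 1 → matNormLe (fun i j => φ (A i j)) c

/-- The completely bounded norm of `φ` as a map on `M`. -/
def cbNormOn (M : VonNeumannAlgebra H) (φ : (H →L[ℂ] H) →ₗ[ℂ] (H →L[ℂ] H)) : ℝ :=
  sInf {c : ℝ | 0 ≤ c ∧ CBBoundOn M φ c}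

/-- `φ` is completely bounded as a map on `M`. -/
def IsCBOn (M : VonNeumannAlgebra H) (φ : (H →L[ℂ] H) →ₗ[ℂ] (H →L[ℂ] H)) : Prop :=
  ∃ c, 0 ≤ c ∧ CBBoundOn M φ c

/-- `φ` is normal as a map on `M`: every normal functional composed with `φ`
is again normal (i.e. implemented by a trace class operator). -/
def NormalOn {ι : Type*} (b : HilbertBasis ι ℂ H) (M : VonNeumannAlgebra H)
    (φ : (H →L[ℂ] H) →ₗ[ℂ] (H →L[ℂ] H)) : Prop :=
  ∀ T, IsTraceClass T → ∃ T', IsTraceClass T' ∧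
    ∀ A ∈ M, pairing b (φ A) T = pairing b A T'

/-- The map `Ad_V : X ↦ V* X V`. -/
def AdL (V : H →L[ℂ] H) : (H →L[ℂ] H) →ₗ[ℂ] (H →L[ℂ] H) where
  toFun X := star V * X * V
  map_add' X Y := by simp [add_mul, mul_add]
  map_smul' c X := by simp [smul_mul_assoc, mul_smul_comm]

/-- `p` is a minimal (nonzero) projection in `M`. -/
def IsMinimalProjection (M : VonNeumannAlgebra H) (p : H →L[ℂ] H) : Prop :=
  p ∈ M ∧ IsIdempotentElem p ∧ IsSelfAdjoint p ∧ p ≠ 0 ∧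
    ∀ q, q ∈ M → IsIdempotentElem q → IsSelfAdjoint q → q ≠ 0 →
      q * p = q → p * q = q → q = p

/-- A factor is of type I precisely when it contains a minimal projection. -/
def IsTypeI (M : VonNeumannAlgebra H) : Prop :=
  ∃ p, IsMinimalProjection M p




variable {K : Type*} [NormedAddCommGroup K] [InnerProductSpace ℂ K] [CompleteSpace K]

/-- `T` is a Hilbert–Schmidt operator (relative to a Hilbert basis `e`;
this does not depend on the choice of `e`). -/
def IsHS {ι : Type*} (e : HilbertBasis ι ℂ K) (T : K →L[ℂ] K) : Prop :=
  Summable fun i => ‖T (e i)‖ ^ 2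

/-- A model of the Hilbert space `HS(K)` of Hilbert–Schmidt operators on `K`,
with `B(K)` acting by left multiplications `Lmul` and right multiplications
`Rmul`.  `toOp` regards a vector of `H` as an operator on `K`; its range is
exactly the set of Hilbert–Schmidt operators, and the inner product of `H` is
`(x|y) = Tr (x y*)`, i.e. `⟪x, y⟫ = Σᵢ ⟪x eᵢ, y eᵢ⟫`. -/
structure HSModel {ι : Type*} (e : HilbertBasis ι ℂ K) (H : Type*)
    [NormedAddCommGroup H] [InnerProductSpace ℂ H] [CompleteSpace H] where
  toOp : H →ₗ[ℂ] (K →L[ℂ] K)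
  inj : Function.Injective toOp
  mem_range : ∀ T : K →L[ℂ] K, IsHS e T ↔ ∃ x : H, toOp x = T
  inner_eq : ∀ x y : H, ⟪x, y⟫ = ∑' i, ⟪toOp x (e i), toOp y (e i)⟫
  Lmul : (K →L[ℂ] K) → (H →L[ℂ] H)
  Lmul_eq : ∀ a x, toOp (Lmul a x) = a ∘L toOp x
  Rmul : (K →L[ℂ] K) → (H →L[ℂ] H)
  Rmul_eq : ∀ a x, toOp (Rmul a x) = toOp x ∘L a

/-- The operator `T` has rank at most `k`. -/
def rankLE (T : K →L[ℂ] K) (k : ℕ) : Prop :=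
  Module.rank ℂ (LinearMap.range (T : K →ₗ[ℂ] K)) ≤ (k : Cardinal)

variable {H : Type*} [NormedAddCommGroup H] [InnerProductSpace ℂ H] [CompleteSpace H]
  {ι : Type*} {e : HilbertBasis ι ℂ K}

/-- `Φ` restricts to the map `φ̃ : R_y L_x ↦ R_y L_{φ(x)}` on `alg(M', M)` for
`M = L_{B(K)}`. -/
def HSExt (m : HSModel e H) (φ : (K →L[ℂ] K) →ₗ[ℂ] (K →L[ℂ] K))
    (Φ : (H →L[ℂ] H) →ₗ[ℂ] (H →L[ℂ] H)) : Prop :=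
  ∀ a x : K →L[ℂ] K, Φ (m.Rmul a ∘L m.Lmul x) = m.Rmul a ∘L m.Lmul (φ x)

/-- `φ` is `k`-positive. -/
def kPos (k : ℕ) (φ : (K →L[ℂ] K) →ₗ[ℂ] (K →L[ℂ] K)) : Prop :=
  ∀ A : Fin k → Fin k → (K →L[ℂ] K), MatPos A → MatPos fun i j => φ (A i j)

/-- `φ` is completely bounded (as a map on all of `B(K)`). -/
def IsCBFullK (φ : (K →L[ℂ] K) →ₗ[ℂ] (K →L[ℂ] K)) : Prop :=
  ∃ c, 0 ≤ c ∧ ∀ (k : ℕ) (A : Fin k → Fin k → (K →L[ℂ] K)),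
    matNormLe A 1 → matNormLe (fun i j => φ (A i j)) c

/-- `φ` belongs to `CB^σ(B(K))`: it is normal and completely bounded. -/
def NormalCB (e : HilbertBasis ι ℂ K) (φ : (K →L[ℂ] K) →ₗ[ℂ] (K →L[ℂ] K)) : Prop :=
  (∃ φst, IsNormalPair e φ φst) ∧ IsCBFullK φ

/-- The cone `𝒮_k` of `T(H)`: the trace-norm closed convex cone generated by
the `ω_{x,x} = x ⊠ x` with `rank x ≤ k` (rank as an operator on `K`). -/
def SchmidtCone (m : HSModel e H) (k : ℕ) : Set (H →L[ℂ] H) :=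
  {T | ∀ ε : ℝ, 0 < ε → ∃ (n : ℕ) (x : Fin n → H),
    (∀ i, rankLE (m.toOp (x i)) k) ∧
      traceNorm (T - ∑ i, rankOne (x i) (x i)) < ε}

/-- `ψ` belongs to the convex cone `𝔼_k` generated by the maps `Ad_V` with
`rank V ≤ k`. -/
def InEk (k : ℕ) (ψ : (K →L[ℂ] K) →ₗ[ℂ] (K →L[ℂ] K)) : Prop :=
  ∃ (n : ℕ) (V : Fin n → (K →L[ℂ] K)), (∀ i, rankLE (V i) k) ∧
    ∀ x, ψ x = ∑ i, star (V i) * x * V i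

/-- `φ` (with Choi trace-class operator `Dphi = D_φ`) is `k`-superpositive:
it lies in the `‖·‖_D`-closure of the cone `𝔼_k`, where `‖ψ‖_D = ‖D_ψ‖_{T(H)}`. -/
def kSuper {ιH : Type*} (bH : HilbertBasis ιH ℂ H) (m : HSModel e H) (x0 : H)
    (k : ℕ) (Dphi : H →L[ℂ] H) : Prop :=
  ∀ ε : ℝ, 0 < ε → ∃ ψ Ψ Ψst, InEk k ψ ∧ HSExt m ψ Ψ ∧ IsNormalPair bH Ψ Ψst ∧
    traceNorm (Dphi - Ψst (rankOne x0 x0)) < ε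

set_option linter.unusedSectionVars false

section Nuclear

variable {E : Type*} [NormedAddCommGroup E] [InnerProductSpace ℂ E] [CompleteSpace E]

/-- Cauchy–Schwarz for families with bounded finite square sums. -/
theorem summable_mul_and_tsum_mul_le {α : Type*} {f g : α → ℝ} {A B : ℝ}
    (hf0 : ∀ a, 0 ≤ f a) (hg0 : ∀ a, 0 ≤ g a) (hA : 0 ≤ A) (hB : 0 ≤ B)
    (hf : ∀ s : Finset α, ∑ a ∈ s, f a ^ 2 ≤ A ^ 2)
    (hg : ∀ s : Finset α, ∑ a ∈ s, g a ^ 2 ≤ B ^ 2) :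
    Summable (fun a => f a * g a) ∧ ∑' a, f a * g a ≤ A * B := by
  have key : ∀ s : Finset α, ∑ a ∈ s, f a * g a ≤ A * B := fun s =>
    (Real.sum_mul_le_sqrt_mul_sqrt s f g).trans
      (mul_le_mul (Real.sqrt_le_left hA |>.mpr (hf s) |>.trans le_rfl)
        (Real.sqrt_le_left hB |>.mpr (hg s)) (Real.sqrt_nonneg _) hA)
  have h0 : ∀ a, 0 ≤ f a * g a := fun a => mul_nonneg (hf0 a) (hg0 a)
  exact ⟨summable_of_sum_le h0 key, Real.tsum_le_of_sum_le h0 key⟩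

theorem bessel_hilbertBasis {ι : Type*} (b : HilbertBasis ι ℂ E) (x : E) (s : Finset ι) :
    ∑ i ∈ s, ‖⟪b i, x⟫‖ ^ 2 ≤ ‖x‖ ^ 2 :=
  b.orthonormal.sum_inner_products_le x

theorem summable_inner_of_nuclear {α : Type*} {x y : α → E}
    (hs : Summable fun a => ‖x a‖ * ‖y a‖) (A : E →L[ℂ] E) :
    Summable fun a => ⟪y a, A (x a)⟫ := by
  refine Summable.of_norm_bounded (hs.mul_left ‖A‖) fun a => ?_
  calc ‖⟪y a, A (x a)⟫‖ ≤ ‖y a‖ * ‖A (x a)‖ := norm_inner_le_norm _ _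
    _ ≤ ‖y a‖ * (‖A‖ * ‖x a‖) := by gcongr; exact A.le_opNorm _
    _ = _ := by ring

theorem summable_smul_of_nuclear {α : Type*} {x y : α → E}
    (hs : Summable fun a => ‖x a‖ * ‖y a‖) (z : E) :
    Summable fun a => ⟪y a, z⟫ • x a := by
  refine Summable.of_norm_bounded (hs.mul_right ‖z‖) fun a => ?_
  rw [norm_smul]
  calc ‖⟪y a, z⟫‖ * ‖x a‖ ≤ (‖y a‖ * ‖z‖) * ‖x a‖ := by
        gcongr; exact norm_inner_le_norm _ _
    _ = _ := by ring

/-- The trace pairing computed from a nuclear representation. -/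
theorem pairing_eq_tsum {ι : Type*} (b : HilbertBasis ι ℂ E) {α : Type*} {x y : α → E}
    (hs : Summable fun a => ‖x a‖ * ‖y a‖) {T : E →L[ℂ] E}
    (hT : ∀ z, T z = ∑' a, ⟪y a, z⟫ • x a) (A : E →L[ℂ] E) :
    pairing b A T = ∑' a, ⟪y a, A (x a)⟫ := by
  have cs : ∀ a, Summable (fun i => ‖⟪b i, y a⟫‖ * ‖⟪b i, A (x a)⟫‖) ∧
      ∑' i, ‖⟪b i, y a⟫‖ * ‖⟪b i, A (x a)⟫‖ ≤ ‖y a‖ * ‖A (x a)‖ := fun a =>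
    summable_mul_and_tsum_mul_le (fun _ => norm_nonneg _) (fun _ => norm_nonneg _)
      (norm_nonneg _) (norm_nonneg _) (bessel_hilbertBasis b _) (bessel_hilbertBasis b _)
  have hn : ∀ a i, ‖⟪y a, b i⟫ * ⟪b i, A (x a)⟫‖ = ‖⟪b i, y a⟫‖ * ‖⟪b i, A (x a)⟫‖ := by
    intro a i
    rw [norm_mul, norm_inner_symm]
  have hsum : Summable (fun p : α × ι => ⟪y p.1, b p.2⟫ * ⟪b p.2, A (x p.1)⟫) := by
    apply Summable.of_norm
    rw [summable_prod_of_nonneg (fun _ => norm_nonneg _)]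
    simp only [hn]
    refine ⟨fun a => (cs a).1, ?_⟩
    refine Summable.of_nonneg_of_le (fun a => tsum_nonneg fun i => by positivity)
      (fun a => ((cs a).2.trans ?_)) (hs.mul_left ‖A‖)
    calc ‖y a‖ * ‖A (x a)‖ ≤ ‖y a‖ * (‖A‖ * ‖x a‖) := by gcongr; exact A.le_opNorm _
      _ = _ := by ring
  have h1 : pairing b A T = ∑' i, ∑' a, ⟪y a, b i⟫ * ⟪b i, A (x a)⟫ := by
    unfold pairing tr
    congr 1
    ext i
    have := (((innerSL ℂ (b i)).comp A).hasSum (summable_smul_of_nuclear hs (b i)).hasSum)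
    simp only [ContinuousLinearMap.comp_apply, map_smul, innerSL_apply_apply,
      smul_eq_mul] at this
    rw [this.tsum_eq, ContinuousLinearMap.comp_apply, hT]
  rw [h1, Summable.tsum_comm' (f := fun a i => ⟪y a, b i⟫ * ⟪b i, A (x a)⟫) hsum
    (fun a => b.summable_inner_mul_inner _ _)
    (fun i => ((Equiv.prodComm ι α).summable_iff.mpr hsum).prod_factor i)]
  congr 1
  ext a
  exact (b.hasSum_inner_mul_inner (y a) (A (x a))).tsum_eq

theorem isTraceClass_of_nuclear {α : Type*} {x y : α → E}
    (hs : Summable fun a => ‖x a‖ * ‖y a‖) {T : E →L[ℂ] E}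
    (hT : ∀ z, T z = ∑' a, ⟪y a, z⟫ • x a) : IsTraceClass T := by
  have hc : (Function.support fun a => ‖x a‖ * ‖y a‖).Countable := hs.countable_support
  set S := Function.support fun a => ‖x a‖ * ‖y a‖ with hS
  have : Countable S := hc
  obtain ⟨f, hf⟩ := exists_injective_nat S
  have hnS : ∀ a, a ∉ S → x a = 0 ∨ y a = 0 := by
    intro a ha
    simpa [hS, or_iff_not_imp_left] using ha
  refine ⟨Function.extend f (fun a => x a) 0, Function.extend f (fun a => y a) 0, ?_, ?_⟩
  · rw [← hf.summable_iff]
    · have h2 : Summable fun a : S => ‖x a‖ * ‖y a‖ := hs.subtype S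
      simpa only [Function.comp_def, hf.extend_apply] using h2
    · intro n hn
      rw [Function.extend_apply' _ _ _ (by simpa using hn)]
      simp
  · intro z
    rw [hT]
    have h1 : ∑' a, ⟪y a, z⟫ • x a = ∑' a : S, ⟪y a, z⟫ • x a := by
      refine (tsum_subtype_eq_of_support_subset (f := fun a => ⟪y a, z⟫ • x a) ?_).symm
      intro a ha
      by_contra h
      rcases hnS a h with h | h <;> simp [h] at ha
    rw [h1, ← hf.tsum_eq]
    · simp [hf.extend_apply]
    · intro n hn
      by_contra h
      rw [Function.mem_support, Function.extend_apply' _ _ _ (by simpa using h)] at hn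
      simp at hn

/-- Every absolutely convergent sum of vector functionals is implemented by a trace class
operator. -/
theorem exists_isTraceClass {ι : Type*} (b : HilbertBasis ι ℂ E) {α : Type*} {x y : α → E}
    (hs : Summable fun a => ‖x a‖ * ‖y a‖) :
    ∃ T, IsTraceClass T ∧ ∀ A, pairing b A T = ∑' a, ⟪y a, A (x a)⟫ := by
  have hs' : Summable fun a => rankOne (x a) (y a) := by
    refine Summable.of_norm_bounded hs fun a => ?_
    refine ContinuousLinearMap.opNorm_le_bound _ (by positivity) fun z => ?_
    simp only [rankOne, smulRight_apply, innerSL_apply_apply, norm_smul]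
    calc ‖⟪y a, z⟫‖ * ‖x a‖ ≤ (‖y a‖ * ‖z‖) * ‖x a‖ := by
          gcongr; exact norm_inner_le_norm _ _
      _ = _ := by ring
  have hT : ∀ z, (∑' a, rankOne (x a) (y a)) z = ∑' a, ⟪y a, z⟫ • x a := by
    intro z
    have := ((ContinuousLinearMap.apply ℂ E z).hasSum hs'.hasSum)
    simpa [rankOne, Function.comp_def] using this.tsum_eq.symm
  exact ⟨_, isTraceClass_of_nuclear hs hT, fun A => pairing_eq_tsum b hs hT A⟩

theorem IsTraceClass.isCompactOperator {T : E →L[ℂ] E} (h : IsTraceClass T) :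
    IsCompactOperator T := by
  obtain ⟨x, y, hs, hT⟩ := h
  have hs' : Summable fun a => rankOne (x a) (y a) := by
    refine Summable.of_norm_bounded hs fun a => ?_
    refine ContinuousLinearMap.opNorm_le_bound _ (by positivity) fun z => ?_
    simp only [rankOne, smulRight_apply, innerSL_apply_apply, norm_smul]
    calc ‖⟪y a, z⟫‖ * ‖x a‖ ≤ (‖y a‖ * ‖z‖) * ‖x a‖ := by
          gcongr; exact norm_inner_le_norm _ _
      _ = _ := by ring
  have hT' : T = ∑' a, rankOne (x a) (y a) := by
    ext z
    have := ((ContinuousLinearMap.apply ℂ E z).hasSum hs'.hasSum)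
    rw [hT]
    simpa [rankOne, Function.comp_def] using this.tsum_eq
  have hlim : Filter.Tendsto (fun s : Finset ℕ => ∑ a ∈ s, rankOne (x a) (y a)) Filter.atTop
      (nhds T) := by
    rw [hT']; exact hs'.hasSum
  refine isCompactOperator_of_tendsto hlim (Filter.Eventually.of_forall fun s => ?_)
  have : ∀ s : Finset ℕ, (∑ a ∈ s, rankOne (x a) (y a)) ∈
      compactOperator (RingHom.id ℂ) E E := by
    intro s
    refine Submodule.sum_mem _ fun a _ => ?_
    have h1 : IsCompactOperator (innerSL ℂ (y a)) :=
      isCompactOperator_of_locallyCompactSpace_dom (innerSL ℂ (y a))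
    exact h1.clm_comp ((1 : ℂ →L[ℂ] ℂ).smulRight (x a))
  exact this s

end Nuclear

section TraceClass

variable {E : Type*} [NormedAddCommGroup E] [InnerProductSpace ℂ E] [CompleteSpace E]

theorem isTraceClass_rankOne (x y : E) : IsTraceClass (rankOne x y) :=
  isTraceClass_of_nuclear (α := Unit) (x := fun _ => x) (y := fun _ => y)
    (Summable.of_finite) fun z => by simp [rankOne]

theorem pairing_rankOne {ι : Type*} (b : HilbertBasis ι ℂ E) (A : E →L[ℂ] E) (x y : E) :
    pairing b A (rankOne x y) = ⟪y, A x⟫ := by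
  rw [pairing_eq_tsum b (α := Unit) (x := fun _ => x) (y := fun _ => y)
    (Summable.of_finite) (fun z => by simp [rankOne])]
  simp

theorem rankOne_pairing {ι : Type*} (b : HilbertBasis ι ℂ E) {T : E →L[ℂ] E}
    (h : IsTraceClass T) (u v : E) : pairing b (rankOne u v) T = ⟪v, T u⟫ := by
  obtain ⟨x, y, hs, hT⟩ := h
  rw [pairing_eq_tsum b hs hT, hT]
  have := ((innerSL ℂ v).hasSum (summable_smul_of_nuclear hs u).hasSum).tsum_eq
  simp only [map_smul, innerSL_apply_apply, smul_eq_mul] at this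
  rw [← this]
  congr 1
  ext a
  simp [rankOne, mul_comm]

theorem IsTraceClass.add {S T : E →L[ℂ] E} (hS : IsTraceClass S) (hT : IsTraceClass T) :
    IsTraceClass (S + T) := by
  obtain ⟨x, y, hs, h⟩ := hS
  obtain ⟨x', y', hs', h'⟩ := hT
  refine isTraceClass_of_nuclear (α := ℕ ⊕ ℕ) (x := Sum.elim x x') (y := Sum.elim y y') ?_ ?_
  · have := HasSum.sum (f := fun a : ℕ ⊕ ℕ => ‖Sum.elim x x' a‖ * ‖Sum.elim y y' a‖)
      hs.hasSum hs'.hasSum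
    exact this.summable
  · intro z
    have h1 := (summable_smul_of_nuclear hs z).hasSum
    have h2 := (summable_smul_of_nuclear hs' z).hasSum
    have h3 : HasSum (fun a : ℕ ⊕ ℕ => ⟪Sum.elim y y' a, z⟫ • Sum.elim x x' a)
        (∑' n, ⟪y n, z⟫ • x n + ∑' n, ⟪y' n, z⟫ • x' n) := HasSum.sum h1 h2
    rw [h3.tsum_eq, _root_.add_apply, h, h']

theorem IsTraceClass.mul_left {T : E →L[ℂ] E} (hT : IsTraceClass T) (A : E →L[ℂ] E) :
    IsTraceClass (A * T) := by
  obtain ⟨x, y, hs, h⟩ := hT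
  refine isTraceClass_of_nuclear (x := fun n => A (x n)) (y := y) ?_ ?_
  · refine Summable.of_nonneg_of_le (fun _ => by positivity) (fun n => ?_) (hs.mul_left ‖A‖)
    rw [← mul_assoc]
    gcongr
    exact A.le_opNorm _
  · intro z
    rw [mul_apply_eq_comp, h, ← (A.hasSum (summable_smul_of_nuclear hs z).hasSum).tsum_eq]
    simp

theorem IsTraceClass.mul_right {T : E →L[ℂ] E} (hT : IsTraceClass T) (A : E →L[ℂ] E) :
    IsTraceClass (T * A) := by
  obtain ⟨x, y, hs, h⟩ := hT
  refine isTraceClass_of_nuclear (x := x) (y := fun n => star A (y n)) ?_ ?_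
  · refine Summable.of_nonneg_of_le (fun _ => by positivity) (fun n => ?_) (hs.mul_left ‖star A‖)
    rw [mul_left_comm]
    gcongr
    exact (star A).le_opNorm _
  · intro z
    rw [mul_apply_eq_comp, h]
    simp [star_eq_adjoint, adjoint_inner_left]

theorem pairing_mul_right {ι : Type*} (b : HilbertBasis ι ℂ E) {T : E →L[ℂ] E}
    (hT : IsTraceClass T) (A B : E →L[ℂ] E) : pairing b A (T * B) = pairing b (B * A) T := by
  obtain ⟨x, y, hs, h⟩ := hT
  rw [pairing_eq_tsum b hs h, pairing_eq_tsum b (x := x) (y := fun n => star B (y n))]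
  · simp [star_eq_adjoint, adjoint_inner_left]
  · refine Summable.of_nonneg_of_le (fun _ => by positivity) (fun n => ?_) (hs.mul_left ‖star B‖)
    rw [mul_left_comm]
    gcongr
    exact (star B).le_opNorm _
  · intro z
    rw [mul_apply_eq_comp, h]
    simp [star_eq_adjoint, adjoint_inner_left]

theorem pairing_mul_left {ι : Type*} (b : HilbertBasis ι ℂ E) (A B T : E →L[ℂ] E) :
    pairing b A (B * T) = pairing b (A * B) T := rfl

theorem IsTraceClass.smul {T : E →L[ℂ] E} (hT : IsTraceClass T) (c : ℂ) :
    IsTraceClass (c • T) := by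
  simpa using hT.mul_left (c • (1 : E →L[ℂ] E))

theorem IsTraceClass.sub {S T : E →L[ℂ] E} (hS : IsTraceClass S) (hT : IsTraceClass T) :
    IsTraceClass (S - T) := by
  simpa [sub_eq_add_neg] using hS.add (hT.smul (-1))

theorem IsTraceClass.star {T : E →L[ℂ] E} (hT : IsTraceClass T) : IsTraceClass (star T) := by
  obtain ⟨x, y, hs, h⟩ := hT
  refine isTraceClass_of_nuclear (x := y) (y := x) (by simpa only [mul_comm] using hs) fun z => ?_
  refine ext_inner_left ℂ fun w => ?_
  have hs' : Summable fun a => ‖y a‖ * ‖x a‖ := by simpa only [mul_comm] using hs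
  have h1 := ((innerSL ℂ w).hasSum (summable_smul_of_nuclear hs' z).hasSum).tsum_eq
  have h2 := ((innerSL ℂ z).hasSum (summable_smul_of_nuclear hs w).hasSum).tsum_eq
  simp only [map_smul, innerSL_apply_apply, smul_eq_mul] at h1 h2
  rw [← h1, star_eq_adjoint, adjoint_inner_right, h, ← inner_conj_symm, ← h2,
    Complex.conj_tsum]
  congr 1
  ext a
  simp [mul_comm]

/-- The subspace of trace class operators. -/
def traceClassSubmodule (E : Type*) [NormedAddCommGroup E] [InnerProductSpace ℂ E]
    [CompleteSpace E] : Submodule ℂ (E →L[ℂ] E) where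
  carrier := {T | IsTraceClass T}
  add_mem' := IsTraceClass.add
  zero_mem' := by simpa using (isTraceClass_rankOne (0 : E) 0).smul 0
  smul_mem' c _ hT := hT.smul c

theorem pairing_add_left {ι : Type*} (b : HilbertBasis ι ℂ E) {T : E →L[ℂ] E}
    (hT : IsTraceClass T) (A B : E →L[ℂ] E) :
    pairing b (A + B) T = pairing b A T + pairing b B T := by
  obtain ⟨x, y, hs, h⟩ := hT
  simp only [pairing_eq_tsum b hs h]
  rw [← (summable_inner_of_nuclear hs A).tsum_add (summable_inner_of_nuclear hs B)]
  simp

theorem pairing_smul_left {ι : Type*} (b : HilbertBasis ι ℂ E) (c : ℂ) (A T : E →L[ℂ] E) :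
    pairing b (c • A) T = c * pairing b A T := by
  simp [pairing, tr, tsum_mul_left]

theorem pairing_smul_right {ι : Type*} (b : HilbertBasis ι ℂ E) (c : ℂ) (A T : E →L[ℂ] E) :
    pairing b A (c • T) = c * pairing b A T := by
  simp [pairing, tr, tsum_mul_left]

theorem summable_pairing {ι : Type*} (b : HilbertBasis ι ℂ E) {T : E →L[ℂ] E}
    (hT : IsTraceClass T) (A : E →L[ℂ] E) : Summable fun i => ⟪b i, A (T (b i))⟫ := by
  obtain ⟨x, y, hs, h⟩ := hT
  have cs : ∀ a, Summable (fun i => ‖⟪b i, y a⟫‖ * ‖⟪b i, A (x a)⟫‖) ∧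
      ∑' i, ‖⟪b i, y a⟫‖ * ‖⟪b i, A (x a)⟫‖ ≤ ‖y a‖ * ‖A (x a)‖ := fun a =>
    summable_mul_and_tsum_mul_le (fun _ => norm_nonneg _) (fun _ => norm_nonneg _)
      (norm_nonneg _) (norm_nonneg _) (bessel_hilbertBasis b _) (bessel_hilbertBasis b _)
  have hn : ∀ a i, ‖⟪y a, b i⟫ * ⟪b i, A (x a)⟫‖ = ‖⟪b i, y a⟫‖ * ‖⟪b i, A (x a)⟫‖ := by
    intro a i
    rw [norm_mul, norm_inner_symm]
  have hsum : Summable (fun p : ℕ × ι => ⟪y p.1, b p.2⟫ * ⟪b p.2, A (x p.1)⟫) := by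
    apply Summable.of_norm
    rw [summable_prod_of_nonneg (fun _ => norm_nonneg _)]
    simp only [hn]
    refine ⟨fun a => (cs a).1, ?_⟩
    refine Summable.of_nonneg_of_le (fun a => tsum_nonneg fun i => by positivity)
      (fun a => ((cs a).2.trans ?_)) (hs.mul_left ‖A‖)
    calc ‖y a‖ * ‖A (x a)‖ ≤ ‖y a‖ * (‖A‖ * ‖x a‖) := by gcongr; exact A.le_opNorm _
      _ = _ := by ring
  have h2 := ((Equiv.prodComm ι ℕ).summable_iff.mpr hsum).prod
  refine h2.congr fun i => ?_
  have := (((innerSL ℂ (b i)).comp A).hasSum (summable_smul_of_nuclear hs (b i)).hasSum)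
  simp only [ContinuousLinearMap.comp_apply, map_smul, innerSL_apply_apply,
    smul_eq_mul] at this
  rw [h, ← this.tsum_eq]
  rfl

theorem pairing_add_right {ι : Type*} (b : HilbertBasis ι ℂ E) {S T : E →L[ℂ] E}
    (hS : IsTraceClass S) (hT : IsTraceClass T) (A : E →L[ℂ] E) :
    pairing b A (S + T) = pairing b A S + pairing b A T := by
  simp only [pairing, tr]
  rw [← Summable.tsum_add]
  · simp
  · exact summable_pairing b hS A
  · exact summable_pairing b hT A

theorem pairing_sub_right {ι : Type*} (b : HilbertBasis ι ℂ E) {S T : E →L[ℂ] E}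
    (hS : IsTraceClass S) (hT : IsTraceClass T) (A : E →L[ℂ] E) :
    pairing b A (S - T) = pairing b A S - pairing b A T := by
  have := pairing_add_right b hS (hT.smul (-1)) A
  rw [pairing_smul_right] at this
  simpa [sub_eq_add_neg] using this

theorem pairing_star_right {ι : Type*} (b : HilbertBasis ι ℂ E) {T : E →L[ℂ] E}
    (hT : IsTraceClass T) (A : E →L[ℂ] E) :
    pairing b A (star T) = starRingEnd ℂ (pairing b (star A) T) := by
  have h1 : pairing b A (star T) = starRingEnd ℂ (pairing b 1 (T * star A)) := by
    simp only [pairing, tr, Complex.conj_tsum]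
    congr 1
    ext i
    simp only [ContinuousLinearMap.comp_apply, one_apply_eq_self,
      mul_apply_eq_comp, inner_conj_symm]
    rw [star_eq_adjoint, star_eq_adjoint, ← adjoint_inner_right, ← adjoint_inner_left A]
  rw [h1, pairing_mul_right b hT]
  simp

theorem eq_zero_of_pairing_eq_zero {ι : Type*} (b : HilbertBasis ι ℂ E) {T : E →L[ℂ] E}
    (hT : IsTraceClass T) (h : ∀ A, pairing b A T = 0) : T = 0 := by
  ext u
  refine ext_inner_left ℂ fun v => ?_
  rw [← rankOne_pairing b hT u v, h]
  simp

/-- A trace class operator has a nuclear representation by square summable families. -/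
theorem IsTraceClass.exists_sq_summable {T : E →L[ℂ] E} (hT : IsTraceClass T) :
    ∃ x y : ℕ → E, Summable (fun n => ‖x n‖ ^ 2) ∧ Summable (fun n => ‖y n‖ ^ 2) ∧
      Summable (fun n => ‖x n‖ * ‖y n‖) ∧ ∀ z, T z = ∑' n, ⟪y n, z⟫ • x n := by
  obtain ⟨x, y, hs, h⟩ := hT
  have key : ∀ u v : E, ‖((√‖v‖ / √‖u‖ : ℝ) : ℂ) • u‖ ≤ √(‖u‖ * ‖v‖) := by
    intro u v
    rw [norm_smul, Complex.norm_real, Real.norm_of_nonneg (by positivity)]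
    rcases eq_or_ne u 0 with rfl | hu
    · simp
    · have : 0 < √‖u‖ := Real.sqrt_pos.mpr (norm_pos_iff.mpr hu)
      rw [Real.sqrt_mul (norm_nonneg u)]
      apply le_of_eq
      field_simp
      rw [Real.sq_sqrt (norm_nonneg u), mul_comm]
  have key2 : ∀ u v : E, ‖((√‖v‖ / √‖u‖ : ℝ) : ℂ) • u‖ ^ 2 ≤ ‖u‖ * ‖v‖ := by
    intro u v
    calc _ ≤ √(‖u‖ * ‖v‖) ^ 2 := by gcongr; exact key u v
      _ = _ := Real.sq_sqrt (by positivity)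
  refine ⟨fun n => ((√‖y n‖ / √‖x n‖ : ℝ) : ℂ) • x n, fun n => ((√‖x n‖ / √‖y n‖ : ℝ) : ℂ) • y n,
    Summable.of_nonneg_of_le (fun _ => by positivity) (fun n => key2 _ _) hs,
    Summable.of_nonneg_of_le (fun _ => by positivity)
      (fun n => (key2 _ _).trans_eq (mul_comm _ _)) hs,
    Summable.of_nonneg_of_le (fun _ => by positivity) (fun n => ?_) hs, fun z => ?_⟩
  · calc _ ≤ √(‖x n‖ * ‖y n‖) * √(‖y n‖ * ‖x n‖) := by gcongr <;> exact key _ _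
      _ = _ := by rw [mul_comm ‖y n‖, Real.mul_self_sqrt (by positivity)]
  · rw [h]
    congr 1
    ext n
    rcases eq_or_ne (x n) 0 with hx | hx
    · simp [hx]
    rcases eq_or_ne (y n) 0 with hy | hy
    · simp [hy]
    have h1 : (√‖x n‖ : ℂ) ≠ 0 := by
      exact_mod_cast (Real.sqrt_pos.mpr (norm_pos_iff.mpr hx)).ne'
    have h2 : (√‖y n‖ : ℂ) ≠ 0 := by
      exact_mod_cast (Real.sqrt_pos.mpr (norm_pos_iff.mpr hy)).ne'
    rw [inner_smul_left, smul_smul]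
    congr 1
    simp only [Complex.conj_ofReal]
    push_cast
    field_simp

end TraceClass

section Density

variable {E : Type*} [NormedAddCommGroup E] [InnerProductSpace ℂ E] [CompleteSpace E]

theorem starProjection_mul_comm (K : Submodule ℂ E) [K.HasOrthogonalProjection] {X : E →L[ℂ] E}
    (h : ∀ x ∈ K, X x ∈ K) (h' : ∀ x ∈ K, star X x ∈ K) :
    K.starProjection * X = X * K.starProjection := by
  ext x
  simp only [mul_apply_eq_comp]
  have hx : X x = X (K.starProjection x) + X (x - K.starProjection x) := by simp
  have h1 : X (x - K.starProjection x) ∈ Kᗮ := by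
    rw [Submodule.mem_orthogonal]
    intro u hu
    rw [← adjoint_inner_left]
    exact (K.sub_starProjection_mem_orthogonal x) _ (h' u hu)
  rw [hx, map_add, Submodule.starProjection_eq_self_iff.mpr
    (h _ (Submodule.starProjection_apply_mem K x)),
    (Submodule.starProjection_apply_eq_zero_iff K).mpr h1, add_zero]

/-- The diagonal amplification of an operator to `ℓ²(ℕ, E)`. -/
def diag (X : E →L[ℂ] E) : lp (fun _ : ℕ => E) 2 →L[ℂ] lp (fun _ : ℕ => E) 2 :=
  LinearMap.mkContinuous
    { toFun := fun f => ⟨fun n => X (f n), by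
        have hf := (memℓp_gen_iff (p := 2) (by simp)).mp (lp.memℓp f)
        refine memℓp_gen ?_
        refine Summable.of_nonneg_of_le (fun _ => by positivity) (fun n => ?_)
          (hf.mul_left (‖X‖ ^ (2 : ℝ)))
        simp only [ENNReal.toReal_ofNat]
        rw [← Real.mul_rpow (norm_nonneg _) (norm_nonneg _)]
        exact Real.rpow_le_rpow (norm_nonneg _) (X.le_opNorm _) (by norm_num)⟩
      map_add' := fun f g => by ext n; exact map_add X (f n) (g n)
      map_smul' := fun c f => by ext n; simp } ‖X‖ (fun f => by
        refine lp.norm_le_of_tsum_le (by simp) (by positivity) ?_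
        have hf := (memℓp_gen_iff (p := 2) (by simp)).mp (lp.memℓp f)
        have h1 := lp.norm_rpow_eq_tsum (p := 2) (by simp) f
        rw [Real.mul_rpow (norm_nonneg _) (norm_nonneg _), h1, ← tsum_mul_left]
        have hle : ∀ n, ‖X (f n)‖ ^ (2 : ENNReal).toReal ≤
            ‖X‖ ^ (2 : ENNReal).toReal * ‖f n‖ ^ (2 : ENNReal).toReal := fun n => by
          rw [← Real.mul_rpow (norm_nonneg _) (norm_nonneg _)]
          exact Real.rpow_le_rpow (norm_nonneg _) (X.le_opNorm _) (by simp)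
        exact Summable.tsum_le_tsum hle
          (Summable.of_nonneg_of_le (fun _ => by positivity) hle (hf.mul_left _)) (hf.mul_left _))

theorem diag_apply (X : E →L[ℂ] E) (f : lp (fun _ : ℕ => E) 2) (n : ℕ) :
    diag X f n = X (f n) := rfl

theorem star_diag (X : E →L[ℂ] E) : star (diag X) = diag (star X) := by
  refine (ContinuousLinearMap.eq_adjoint_iff _ _).mpr (fun f g => ?_) |>.symm
  simp [lp.inner_eq_tsum, diag_apply, star_eq_adjoint, adjoint_inner_left]

/-- The inclusion of the `n`-th coordinate into `ℓ²(ℕ, E)`. -/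
def coordIncl (E : Type*) [NormedAddCommGroup E] [InnerProductSpace ℂ E] (n : ℕ) :
    E →L[ℂ] lp (fun _ : ℕ => E) 2 :=
  (lp.lsingle (𝕜 := ℂ) (E := fun _ : ℕ => E) 2 n).mkContinuous 1 fun x => by
    rw [one_mul]
    exact (lp.norm_single (E := fun _ : ℕ => E) (p := 2) (by simp) n x).le

theorem coordIncl_apply (n : ℕ) (x : E) :
    coordIncl E n x = lp.single (E := fun _ : ℕ => E) 2 n x := rfl

theorem diag_comp_coordIncl (X : E →L[ℂ] E) (n : ℕ) :
    diag X ∘L coordIncl E n = coordIncl E n ∘L X := by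
  ext x m
  rcases eq_or_ne m n with rfl | h
  · simp [diag_apply, coordIncl_apply]
  · simp [diag_apply, coordIncl_apply, h]

theorem adjoint_coordIncl_comp_diag (X : E →L[ℂ] E) (n : ℕ) :
    adjoint (coordIncl E n) ∘L diag X = X ∘L adjoint (coordIncl E n) := by
  have h := congrArg adjoint (diag_comp_coordIncl (star X) n)
  rw [adjoint_comp, adjoint_comp, ← star_diag] at h
  simpa [star_eq_adjoint] using h

theorem ext_of_coordIncl {S T : lp (fun _ : ℕ => E) 2 →L[ℂ] lp (fun _ : ℕ => E) 2}
    (h : ∀ m n, adjoint (coordIncl E m) ∘L S ∘L coordIncl E n =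
      adjoint (coordIncl E m) ∘L T ∘L coordIncl E n) : S = T := by
  have h1 : ∀ n x, S (coordIncl E n x) = T (coordIncl E n x) := by
    intro n x
    ext m
    refine ext_inner_left ℂ fun u => ?_
    have := congrArg (fun A : E →L[ℂ] E => ⟪u, A x⟫) (h m n)
    simp only [ContinuousLinearMap.comp_apply, adjoint_inner_right, coordIncl_apply] at this
    simpa [coordIncl_apply, lp.inner_single_left] using this
  ext f : 1
  have hs := lp.hasSum_single (E := fun _ : ℕ => E) (p := 2) (by simp) f
  have h2 := S.hasSum hs
  have h3 := T.hasSum hs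
  simp only [← coordIncl_apply, h1] at h2 h3
  exact h2.unique h3

variable {ι : Type*} (b : HilbertBasis ι ℂ E)

theorem eq_zero_of_pairing_alg_eq_zero {M : VonNeumannAlgebra E} (hM : IsFactor M)
    {S : E →L[ℂ] E} (hS : IsTraceClass S)
    (h : ∀ A' ∈ M.commutant, ∀ B ∈ M, pairing b (A' * B) S = 0) : S = 0 := by
  obtain ⟨x, y, hx, hy, hxy, hSx⟩ := hS.exists_sq_summable
  have hpair := pairing_eq_tsum b hxy hSx
  have hx' : Memℓp (E := fun _ : ℕ => E) x 2 := memℓp_gen (by simpa using hx)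
  have hy' : Memℓp (E := fun _ : ℕ => E) y 2 := memℓp_gen (by simpa using hy)
  set X : lp (fun _ : ℕ => E) 2 := ⟨x, hx'⟩ with hX
  set Y : lp (fun _ : ℕ => E) 2 := ⟨y, hy'⟩ with hY
  have hpair' : ∀ A, pairing b A S = ⟪Y, diag A X⟫ := fun A => by
    rw [hpair, lp.inner_eq_tsum]; rfl
  have diag_mul : ∀ A B : E →L[ℂ] E, ∀ f, diag (A * B) f = diag A (diag B f) :=
    fun A B f => rfl
  set s : Set (lp (fun _ : ℕ => E) 2) :=
    {z | ∃ A' ∈ M.commutant, ∃ B ∈ M, diag (A' * B) X = z} with hs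
  set K := (Submodule.span ℂ s).topologicalClosure with hK
  have : CompleteSpace K := (Submodule.isClosed_topologicalClosure _).completeSpace_coe
  have inv : ∀ T : lp (fun _ : ℕ => E) 2 →L[ℂ] lp (fun _ : ℕ => E) 2, (∀ z ∈ s, T z ∈ s) →
      ∀ z ∈ K, T z ∈ K := by
    intro T hT z hz
    have : Submodule.span ℂ s ≤ (Submodule.span ℂ s).comap (T : _ →ₗ[ℂ] _) :=
      Submodule.span_le.mpr fun z hz => Submodule.subset_span (hT z hz)
    exact map_mem_closure T.continuous hz fun z hz => this hz
  have invM : ∀ B ∈ M, ∀ z ∈ s, diag B z ∈ s := by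
    rintro B hB _ ⟨A', hA', C, hC, rfl⟩
    refine ⟨A', hA', B * C, mul_mem hB hC, ?_⟩
    rw [← diag_mul, ← mul_assoc, ← mul_assoc, VonNeumannAlgebra.mem_commutant_iff.mp hA' B hB]
  have invM' : ∀ B ∈ M.commutant, ∀ z ∈ s, diag B z ∈ s := by
    rintro B hB _ ⟨A', hA', C, hC, rfl⟩
    exact ⟨B * A', mul_mem hB hA', C, hC, by rw [← diag_mul, ← mul_assoc]⟩
  set P := K.starProjection with hP
  have hcomm : ∀ B, (B ∈ M ∨ B ∈ M.commutant) → P * diag B = diag B * P := by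
    rintro B (hB | hB)
    · exact starProjection_mul_comm K (inv _ (invM B hB))
        (by rw [star_diag]; exact inv _ (invM _ (star_mem hB)))
    · exact starProjection_mul_comm K (inv _ (invM' B hB))
        (by rw [star_diag]; exact inv _ (invM' _ (star_mem hB)))
  set e : ℕ → ℕ → E →L[ℂ] E := fun m n => adjoint (coordIncl E m) ∘L P ∘L coordIncl E n with he
  have e1 : ∀ B m n, e m n * B = adjoint (coordIncl E m) ∘L (P * diag B) ∘L coordIncl E n := by
    intro B m n
    calc e m n * B = adjoint (coordIncl E m) ∘L P ∘L (coordIncl E n ∘L B) := rfl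
      _ = _ := by rw [← diag_comp_coordIncl]; rfl
  have e2 : ∀ B m n, B * e m n = adjoint (coordIncl E m) ∘L (diag B * P) ∘L coordIncl E n := by
    intro B m n
    calc B * e m n = (B ∘L adjoint (coordIncl E m)) ∘L P ∘L coordIncl E n := rfl
      _ = _ := by rw [← adjoint_coordIncl_comp_diag]; rfl
  have esc : ∀ m n, ∃ c : ℂ, e m n = c • (1 : E →L[ℂ] E) := by
    intro m n
    refine hM _ ?_ ?_
    · rw [← M.commutant_commutant, VonNeumannAlgebra.mem_commutant_iff]
      intro g hg
      rw [e1, e2, hcomm g (Or.inr hg)]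
    · rw [VonNeumannAlgebra.mem_commutant_iff]
      intro g hg
      rw [e1, e2, hcomm g (Or.inl hg)]
  have hall : ∀ B, P * diag B = diag B * P := by
    intro B
    refine ext_of_coordIncl fun m n => ?_
    rw [← e1, ← e2]
    obtain ⟨c, hc⟩ := esc m n
    simp [hc]
  have hXK : X ∈ K := Submodule.le_topologicalClosure _ (Submodule.subset_span
    ⟨1, one_mem _, 1, one_mem _, by rw [one_mul]; rfl⟩)
  have hYK : Y ∈ Kᗮ := by
    rw [hK, Submodule.orthogonal_closure, Submodule.mem_orthogonal']
    intro u hu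
    induction hu using Submodule.span_induction with
    | mem z hz =>
      obtain ⟨A', hA', B, hB, rfl⟩ := hz
      rw [← hpair', h A' hA' B hB]
    | zero => simp
    | add _ _ _ _ h1 h2 => rw [inner_add_right, h1, h2, add_zero]
    | smul c _ _ h1 => rw [inner_smul_right, h1, mul_zero]
  refine eq_zero_of_pairing_eq_zero b hS fun A => ?_
  rw [hpair']
  have h1 : diag A X = P (diag A X) := by
    have := congrArg (fun T => T X) (hall A)
    simp only [mul_apply_eq_comp] at this
    rw [this, Submodule.starProjection_eq_self_iff.mpr hXK]
  rw [h1]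
  exact Submodule.inner_left_of_mem_orthogonal (Submodule.starProjection_apply_mem K _) hYK

end Density

section Minimal

variable {E : Type*} [NormedAddCommGroup E] [InnerProductSpace ℂ E] [CompleteSpace E]

/-- The closed subspace generated by the orbit of `ξ` under a set of operators. -/
def orbit (s : Set (E →L[ℂ] E)) (ξ : E) : Submodule ℂ E :=
  (Submodule.span ℂ {z | ∃ A ∈ s, A ξ = z}).topologicalClosure

theorem isClosed_orbit (s : Set (E →L[ℂ] E)) (ξ : E) : IsClosed (orbit s ξ : Set E) :=
  Submodule.isClosed_topologicalClosure _

instance (s : Set (E →L[ℂ] E)) (ξ : E) : CompleteSpace (orbit s ξ) :=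
  (isClosed_orbit s ξ).completeSpace_coe

theorem apply_mem_orbit {s : Set (E →L[ℂ] E)} {A : E →L[ℂ] E} (hA : A ∈ s) (ξ : E) :
    A ξ ∈ orbit s ξ :=
  Submodule.le_topologicalClosure _ (Submodule.subset_span ⟨A, hA, rfl⟩)

theorem orbit_le {s : Set (E →L[ℂ] E)} {ξ : E} {K : Submodule ℂ E} (hK : IsClosed (K : Set E))
    (h : ∀ A ∈ s, A ξ ∈ K) : orbit s ξ ≤ K :=
  Submodule.topologicalClosure_minimal _
    (Submodule.span_le.mpr (by rintro _ ⟨A, hA, rfl⟩; exact h A hA)) hK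

theorem orbit_invariant {s : Set (E →L[ℂ] E)} (hs : ∀ A ∈ s, ∀ B ∈ s, A * B ∈ s) (ξ : E)
    {A : E →L[ℂ] E} (hA : A ∈ s) : ∀ z ∈ orbit s ξ, A z ∈ orbit s ξ := by
  have : orbit s ξ ≤ (orbit s ξ).comap (A : E →ₗ[ℂ] E) :=
    orbit_le ((isClosed_orbit s ξ).preimage A.continuous)
      fun B hB => apply_mem_orbit (hs A hA B hB) ξ
  exact this

theorem starProjection_orbit_comm {s : Set (E →L[ℂ] E)} (hs : ∀ A ∈ s, ∀ B ∈ s, A * B ∈ s)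
    (hs' : ∀ A ∈ s, star A ∈ s) (ξ : E) {A : E →L[ℂ] E} (hA : A ∈ s) :
    (orbit s ξ).starProjection * A = A * (orbit s ξ).starProjection :=
  starProjection_mul_comm _ (orbit_invariant hs ξ hA) (orbit_invariant hs ξ (hs' A hA))

theorem exists_isStarProjection_commutant {N : VonNeumannAlgebra E} {p : E →L[ℂ] E} (hpN : p ∈ N)
    (hp : IsStarProjection p) (hmin : ∀ x ∈ N, ∃ c : ℂ, p * x * p = c • p) (h0 : p ≠ 0) :
    ∃ q ∈ N.commutant, IsStarProjection q ∧ q ≠ 0 ∧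
      ∀ T ∈ N.commutant, ∃ c : ℂ, q * T * q = c • q := by
  obtain ⟨ξ, hpξ, hξ⟩ : ∃ ξ, p ξ = ξ ∧ ξ ≠ 0 := by
    by_contra! hc
    refine h0 ?_
    ext v
    exact hc (p v) (DFunLike.congr_fun hp.isIdempotentElem.eq v)
  set q := (orbit (N : Set (E →L[ℂ] E)) ξ).starProjection with hq
  have hqN : q ∈ N.commutant := VonNeumannAlgebra.mem_commutant_iff.mpr fun g hg =>
    (starProjection_orbit_comm (fun A hA B hB => mul_mem (S := VonNeumannAlgebra E) hA hB)
      (fun A hA => star_mem (S := VonNeumannAlgebra E) hA) ξ hg).symm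
  have hqξ : q ξ = ξ := Submodule.starProjection_eq_self_iff.mpr
    (apply_mem_orbit (s := (N : Set (E →L[ℂ] E))) (one_mem N) ξ)
  refine ⟨q, hqN, isStarProjection_starProjection, fun h => hξ (by rw [← hqξ, h]; rfl),
    fun T hT => ?_⟩
  have hpspan : ∀ z ∈ orbit (N : Set (E →L[ℂ] E)) ξ, p z ∈ Submodule.span ℂ {ξ} := by
    have : orbit (N : Set (E →L[ℂ] E)) ξ ≤ (Submodule.span ℂ {ξ}).comap (p : E →ₗ[ℂ] E) := by
      have hcl : IsClosed ((Submodule.span ℂ {ξ} : Submodule ℂ E) : Set E) :=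
        Submodule.closed_of_finiteDimensional _
      refine orbit_le (hcl.preimage p.continuous) fun x hx => ?_
      obtain ⟨c, hc⟩ := hmin x hx
      have := DFunLike.congr_fun hc ξ
      simp only [mul_apply_eq_comp, hpξ, smul_apply] at this
      exact Submodule.mem_span_singleton.mpr ⟨c, this.symm⟩
    exact this
  have hcom : ∀ S ∈ N.commutant, ∀ n ∈ N, ∀ z, n (S z) = S (n z) := fun S hS n hn z =>
    DFunLike.congr_fun (VonNeumannAlgebra.mem_commutant_iff.mp hS n hn) z
  obtain ⟨c, hc⟩ := Submodule.mem_span_singleton.mp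
    (hpspan (q (T ξ)) (Submodule.starProjection_apply_mem _ _))
  rw [hcom q hqN p hpN, hcom T hT p hpN, hpξ] at hc
  refine ⟨c, ?_⟩
  have key : ∀ z ∈ orbit (N : Set (E →L[ℂ] E)) ξ, q (T z) = c • z := by
    have : orbit (N : Set (E →L[ℂ] E)) ξ ≤
        LinearMap.ker ((q * T - c • (1 : E →L[ℂ] E) : E →L[ℂ] E) : E →ₗ[ℂ] E) := by
      refine orbit_le (ContinuousLinearMap.isClosed_ker _) fun n hn => ?_
      have := congrArg n hc
      rw [map_smul, hcom q hqN n hn, hcom T hT n hn] at this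
      simp [← this]
    intro z hz
    have := this hz
    simpa [sub_eq_zero] using this
  ext z
  exact key (q z) (Submodule.starProjection_apply_mem _ _)

theorem isMinimalProjection_of_corner {N : VonNeumannAlgebra E} {q : E →L[ℂ] E} (hqN : q ∈ N)
    (hq : IsStarProjection q) (h0 : q ≠ 0) (hmin : ∀ x ∈ N, ∃ c : ℂ, q * x * q = c • q) :
    IsMinimalProjection N q := by
  refine ⟨hqN, hq.isIdempotentElem, hq.isSelfAdjoint, h0, fun r hr hri _ hr0 h1 h2 => ?_⟩
  obtain ⟨c, hc⟩ := hmin r hr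
  rw [h2, h1] at hc
  have h3 : (c * c) • q = c • q := by
    have := hri.eq
    rwa [hc, smul_mul_smul_comm, hq.isIdempotentElem.eq] at this
  have hc0 : c ≠ 0 := by
    rintro rfl
    exact hr0 (by rw [hc, zero_smul])
  have h4 : c * c = c := smul_left_injective ℂ h0 h3
  have h5 : c = 1 := by
    have : c * (c - 1) = 0 := by linear_combination h4
    rcases mul_eq_zero.mp this with h | h
    · exact absurd h hc0
    · linear_combination h
  rw [hc, h5, one_smul]

end Minimal

section Slice

variable {E : Type*} [NormedAddCommGroup E] [InnerProductSpace ℂ E] [CompleteSpace E]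
  {ι : Type*} {b : HilbertBasis ι ℂ E} {M : VonNeumannAlgebra E} {x0 : E}

/-- The map `B ↦ ⟪x0, B x0⟫ • 1`. -/
def vectorStateMap (x0 : E) : (E →L[ℂ] E) →ₗ[ℂ] (E →L[ℂ] E) where
  toFun B := ⟪x0, B x0⟫ • 1
  map_add' A B := by simp [add_smul]
  map_smul' c A := by simp [mul_smul]

theorem vectorStateMap_apply (x0 : E) (B : E →L[ℂ] E) :
    vectorStateMap x0 B = ⟪x0, B x0⟫ • (1 : E →L[ℂ] E) := rfl

theorem vectorStateMap_mem (M : VonNeumannAlgebra E) (x0 : E) (B : E →L[ℂ] E) :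
    vectorStateMap x0 B ∈ M := by
  rw [vectorStateMap_apply]
  exact M.toStarSubalgebra.smul_mem (one_mem M) _

theorem normalOn_vectorStateMap (b : HilbertBasis ι ℂ E) (M : VonNeumannAlgebra E) (x0 : E) :
    NormalOn b M (vectorStateMap x0) := fun T _ => by
  refine ⟨pairing b 1 T • rankOne x0 x0, (isTraceClass_rankOne x0 x0).smul _, fun A _ => ?_⟩
  rw [vectorStateMap_apply, pairing_smul_left, pairing_smul_right, pairing_rankOne, mul_comm]

theorem isCBOn_vectorStateMap (b : HilbertBasis ι ℂ E) (M : VonNeumannAlgebra E) {x0 : E}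
    (hx0 : ‖x0‖ = 1) : IsCBOn M (vectorStateMap x0) := by
  refine ⟨1, zero_le_one, fun k A _ hA v w => ?_⟩
  have hsq : ∀ (u : Fin k → E) (s : Finset ι),
      ∑ a ∈ s, √(∑ i, ‖⟪b a, u i⟫‖ ^ 2) ^ 2 ≤ √(∑ i, ‖u i‖ ^ 2) ^ 2 := fun u s => by
    rw [Real.sq_sqrt (by positivity)]
    simp_rw [fun a => Real.sq_sqrt (show 0 ≤ ∑ i, ‖⟪b a, u i⟫‖ ^ 2 by positivity)]
    rw [Finset.sum_comm]
    exact Finset.sum_le_sum fun i _ => bessel_hilbertBasis b (u i) s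
  obtain ⟨hs, hle⟩ := summable_mul_and_tsum_mul_le (fun _ => Real.sqrt_nonneg _)
    (fun _ => Real.sqrt_nonneg _) (Real.sqrt_nonneg _) (Real.sqrt_nonneg _) (hsq v) (hsq w)
  have hterm : ∀ a, ‖∑ i, ∑ j, ⟪x0, A i j x0⟫ * (⟪w i, b a⟫ * ⟪b a, v j⟫)‖ ≤
      √(∑ i, ‖⟪b a, v i⟫‖ ^ 2) * √(∑ i, ‖⟪b a, w i⟫‖ ^ 2) := fun a => by
    have := hA (fun j => ⟪b a, v j⟫ • x0) (fun i => ⟪b a, w i⟫ • x0)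
    simp only [map_smul, inner_smul_left, inner_smul_right, norm_smul, hx0, mul_one, one_mul,
      inner_conj_symm] at this
    refine le_of_eq_of_le (congrArg norm ?_) this
    exact Finset.sum_congr rfl fun i _ => Finset.sum_congr rfl fun j _ => by ring
  have hsum : HasSum (fun a => ∑ i, ∑ j, ⟪x0, A i j x0⟫ * (⟪w i, b a⟫ * ⟪b a, v j⟫))
      (∑ i, ∑ j, ⟪x0, A i j x0⟫ * ⟪w i, v j⟫) :=
    hasSum_sum fun i _ => hasSum_sum fun j _ => (b.hasSum_inner_mul_inner (w i) (v j)).mul_left _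
  simp only [vectorStateMap_apply, smul_apply, one_apply_eq_self, inner_smul_right, one_mul]
  rw [← hsum.tsum_eq]
  exact (tsum_of_norm_bounded hs.hasSum hterm).trans hle

theorem eq_of_pairing_alg_eq (b : HilbertBasis ι ℂ E) (hM : IsFactor M) {S T : E →L[ℂ] E}
    (hS : IsTraceClass S) (hT : IsTraceClass T)
    (h : ∀ A' ∈ M.commutant, ∀ B ∈ M, pairing b (A' * B) S = pairing b (A' * B) T) : S = T := by
  refine sub_eq_zero.mp (eq_zero_of_pairing_alg_eq_zero b hM (hS.sub hT) fun A' hA' B hB => ?_)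
  rw [pairing_sub_right b hS hT, h A' hA' B hB, sub_self]

theorem eq_of_pairing_eq (b : HilbertBasis ι ℂ E) {A B : E →L[ℂ] E}
    (h : ∀ T, IsTraceClass T → pairing b A T = pairing b B T) : A = B := by
  ext u
  refine ext_inner_left ℂ fun v => ?_
  simpa only [pairing_rankOne] using h _ (isTraceClass_rankOne u v)

/-- A normal map on `B(E)` extending `A'B ↦ ⟪x0, B x0⟫ A'`. -/
structure IsSliceExtension (b : HilbertBasis ι ℂ E) (M : VonNeumannAlgebra E) (x0 : E)
    (Φ Φst : (E →L[ℂ] E) →ₗ[ℂ] (E →L[ℂ] E)) : Prop where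
  factor : IsFactor M
  norm_eq : ‖x0‖ = 1
  normal : IsNormalPair b Φ Φst
  ext : ∀ A' ∈ M.commutant, ∀ B ∈ M, Φ (A' * B) = ⟪x0, B x0⟫ • A'

namespace IsSliceExtension

variable {Φ Φst : (E →L[ℂ] E) →ₗ[ℂ] (E →L[ℂ] E)}

theorem pairing_alg (h : IsSliceExtension b M x0 Φ Φst) {A' B T : E →L[ℂ] E}
    (hA' : A' ∈ M.commutant) (hB : B ∈ M)
    (hT : IsTraceClass T) : pairing b (A' * B) (Φst T) = ⟪x0, B x0⟫ * pairing b A' T := by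
  rw [← h.normal.2 _ _ hT, h.ext A' hA' B hB, pairing_smul_left]

theorem apply_mem (h : IsSliceExtension b M x0 Φ Φst) (X : E →L[ℂ] E) : Φ X ∈ M.commutant := by
  rw [VonNeumannAlgebra.mem_commutant_iff]
  intro B hB
  refine eq_of_pairing_eq b fun T hT => ?_
  have key : Φst (T * B) = Φst (B * T) := by
    refine eq_of_pairing_alg_eq b h.factor (h.normal.1 _ (hT.mul_right B))
      (h.normal.1 _ (hT.mul_left B)) fun A' hA' C hC => ?_
    rw [h.pairing_alg hA' hC (hT.mul_right B), h.pairing_alg hA' hC (hT.mul_left B),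
      pairing_mul_right b hT, pairing_mul_left, VonNeumannAlgebra.mem_commutant_iff.mp hA' B hB]
  rw [← pairing_mul_right b hT, h.normal.2 _ _ (hT.mul_right B), key,
    ← h.normal.2 _ _ (hT.mul_left B), pairing_mul_left]

theorem apply_mul_right (h : IsSliceExtension b M x0 Φ Φst) (X : E →L[ℂ] E) {A' : E →L[ℂ] E}
    (hA' : A' ∈ M.commutant) :
    Φ (X * A') = Φ X * A' := by
  refine eq_of_pairing_eq b fun T hT => ?_
  have key : Φst (A' * T) = A' * Φst T := by
    refine eq_of_pairing_alg_eq b h.factor (h.normal.1 _ (hT.mul_left A'))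
      ((h.normal.1 _ hT).mul_left A') fun C' hC' B hB => ?_
    rw [h.pairing_alg hC' hB (hT.mul_left A'), pairing_mul_left, pairing_mul_left, mul_assoc,
      VonNeumannAlgebra.mem_commutant_iff.mp hA' B hB, ← mul_assoc,
      h.pairing_alg (mul_mem hC' hA') hB hT]
  rw [h.normal.2 _ _ hT, ← pairing_mul_left, ← key, ← h.normal.2 _ _ (hT.mul_left A'),
    pairing_mul_left]

theorem apply_mul_left (h : IsSliceExtension b M x0 Φ Φst) (X : E →L[ℂ] E) {A' : E →L[ℂ] E}
    (hA' : A' ∈ M.commutant) :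
    Φ (A' * X) = A' * Φ X := by
  refine eq_of_pairing_eq b fun T hT => ?_
  have hT' := h.normal.1 _ hT
  have key : Φst (T * A') = Φst T * A' := by
    refine eq_of_pairing_alg_eq b h.factor (h.normal.1 _ (hT.mul_right A'))
      (hT'.mul_right A') fun C' hC' B hB => ?_
    rw [h.pairing_alg hC' hB (hT.mul_right A'), pairing_mul_right b hT, pairing_mul_right b hT',
      ← mul_assoc, h.pairing_alg (mul_mem hA' hC') hB hT]
  rw [h.normal.2 _ _ hT, ← pairing_mul_right b hT', ← key, ← h.normal.2 _ _ (hT.mul_right A'),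
    pairing_mul_right b hT]

theorem apply_of_mem (h : IsSliceExtension b M x0 Φ Φst) {A' : E →L[ℂ] E}
    (hA' : A' ∈ M.commutant) : Φ A' = A' := by
  have := h.ext A' hA' 1 (one_mem _)
  simpa [inner_self_eq_norm_sq_to_K, h.norm_eq] using this

theorem isTraceClass_predual (h : IsSliceExtension b M x0 Φ Φst) :
    IsTraceClass (Φst (rankOne x0 x0)) :=
  h.normal.1 _ (isTraceClass_rankOne _ _)

theorem pairing_predual (h : IsSliceExtension b M x0 Φ Φst) (Z : E →L[ℂ] E) :
    pairing b Z (Φst (rankOne x0 x0)) = ⟪x0, Φ Z x0⟫ := by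
  rw [← h.normal.2 _ _ (isTraceClass_rankOne _ _), pairing_rankOne]

theorem isSelfAdjoint_predual (h : IsSliceExtension b M x0 Φ Φst) :
    IsSelfAdjoint (Φst (rankOne x0 x0)) := by
  refine eq_of_pairing_alg_eq b h.factor h.isTraceClass_predual.star h.isTraceClass_predual
    fun A' hA' B hB => ?_
  rw [pairing_star_right b h.isTraceClass_predual, star_mul,
    VonNeumannAlgebra.mem_commutant_iff.mp (star_mem hA') _ (star_mem hB),
    h.pairing_alg (star_mem hA') (star_mem hB) (isTraceClass_rankOne _ _),
    h.pairing_alg hA' hB (isTraceClass_rankOne _ _), pairing_rankOne, pairing_rankOne, map_mul]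
  simp [star_eq_adjoint, adjoint_inner_right]

theorem predual_ne_zero (h : IsSliceExtension b M x0 Φ Φst) : Φst (rankOne x0 x0) ≠ 0 := by
  intro h0
  have h1 := h.pairing_predual 1
  rw [h0, h.apply_of_mem (one_mem _)] at h1
  simp [pairing, tr, inner_self_eq_norm_sq_to_K, h.norm_eq] at h1

variable {u v : E} {α β : ℝ}

theorem pairing_mul_predual (h : IsSliceExtension b M x0 Φ Φst)
    (hv : Φst (rankOne x0 x0) v = (β : ℂ) • v) (Y : E →L[ℂ] E) :
    pairing b (Φ (rankOne v u) * Y) (Φst (rankOne x0 x0)) = β * ⟪u, Φ Y v⟫ := by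
  rw [h.pairing_predual, h.apply_mul_left _ (h.apply_mem _), ← h.apply_mul_right _ (h.apply_mem _),
    ← h.pairing_predual, ← pairing_mul_left,
    rankOne_pairing b (h.isTraceClass_predual.mul_left _), mul_apply_eq_comp, hv, map_smul,
    inner_smul_right]

theorem pairing_mul_predual' (h : IsSliceExtension b M x0 Φ Φst)
    (hu : Φst (rankOne x0 x0) u = (α : ℂ) • u) (Y : E →L[ℂ] E) :
    pairing b (Y * Φ (rankOne v u)) (Φst (rankOne x0 x0)) = α * ⟪u, Φ Y v⟫ := by
  rw [h.pairing_predual, h.apply_mul_right _ (h.apply_mem _), ← h.apply_mul_left _ (h.apply_mem _),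
    ← h.pairing_predual, ← pairing_mul_right b h.isTraceClass_predual,
    rankOne_pairing b (h.isTraceClass_predual.mul_right _), mul_apply_eq_comp,
    ← adjoint_inner_left, ← star_eq_adjoint, h.isSelfAdjoint_predual.star_eq, hu, inner_smul_left,
    Complex.conj_ofReal]

theorem smul_predual_mul (h : IsSliceExtension b M x0 Φ Φst)
    (hu : Φst (rankOne x0 x0) u = (α : ℂ) • u)
    (hv : Φst (rankOne x0 x0) v = (β : ℂ) • v) :
    (α : ℂ) • (Φst (rankOne x0 x0) * Φ (rankOne v u)) =
      (β : ℂ) • (Φ (rankOne v u) * Φst (rankOne x0 x0)) := by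
  have hD := h.isTraceClass_predual
  refine sub_eq_zero.mp (eq_zero_of_pairing_eq_zero b
    (((hD.mul_right _).smul _).sub ((hD.mul_left _).smul _)) fun Y => ?_)
  rw [pairing_sub_right b ((hD.mul_right _).smul _) ((hD.mul_left _).smul _), pairing_smul_right,
    pairing_smul_right, pairing_mul_right b hD, pairing_mul_left, h.pairing_mul_predual hv,
    h.pairing_mul_predual' hu]
  ring

end IsSliceExtension

/-- A nonzero projection commuting with a compact self-adjoint operator and lying in `N`,
whose corner in `N ∩ {D}'` is trivial. -/
theorem exists_corner (N : VonNeumannAlgebra E) {D : E →L[ℂ] E} (hc : IsCompactOperator D)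
    (hD : IsSelfAdjoint D) (h0 : D ≠ 0) :
    ∃ p ∈ N, IsStarProjection p ∧ p ≠ 0 ∧ D * p = p * D ∧
      ∀ z ∈ N, D * z = z * D → ∃ c : ℂ, p * z * p = c • p := by
  have hsym : (D : E →ₗ[ℂ] E).IsSymmetric := hD.isSymmetric
  obtain ⟨μ, hμ, hμ0⟩ : ∃ μ, Module.End.HasEigenvalue (D : Module.End ℂ E) μ ∧ μ ≠ 0 := by
    by_contra! hcon
    exact h0 ((eq_zero_of_forall_hasEigenvalue_eq_zero hc hsym).mp hcon)
  set F := Module.End.eigenspace (D : Module.End ℂ E) μ with hF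
  have hFfin : FiniteDimensional ℂ F := finite_dimensional_eigenspace hc μ hμ0
  have hFmem : ∀ v, v ∈ F ↔ D v = μ • v := fun v => Module.End.mem_eigenspace_iff
  set s : Set (E →L[ℂ] E) := {A | ∀ z ∈ N, D * z = z * D → A * z = z * A} with hs
  have hsmul : ∀ A ∈ s, ∀ B ∈ s, A * B ∈ s := fun A hA B hB z hz hzD => by
    rw [mul_assoc, hB z hz hzD, ← mul_assoc, hA z hz hzD, mul_assoc]
  have hstarD : ∀ z, D * z = z * D → D * star z = star z * D := fun z hz => by
    have := congrArg star hz
    rw [star_mul, star_mul, hD.star_eq] at this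
    exact this.symm
  have hsstar : ∀ A ∈ s, star A ∈ s := fun A hA z hz hzD => by
    have := congrArg star (hA (star z) (star_mem hz) (hstarD z hzD))
    rw [star_mul, star_mul, star_star] at this
    exact this.symm
  have hDs : D ∈ s := fun z _ hzD => hzD
  have h1s : (1 : E →L[ℂ] E) ∈ s := fun z _ _ => by simp
  obtain ⟨ξ, ⟨hξF, hξ0⟩, hξmin⟩ : ∃ ξ ∈ {ξ : E | ξ ∈ F ∧ ξ ≠ 0}, ∀ η ∈ {ξ : E | ξ ∈ F ∧ ξ ≠ 0},
      ¬ Module.finrank ℂ (orbit s η ⊓ F : Submodule ℂ E) <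
        Module.finrank ℂ (orbit s ξ ⊓ F : Submodule ℂ E) := by
    obtain ⟨ξ, hξ⟩ := hμ.exists_hasEigenvector
    exact (InvImage.wf (fun η : E => Module.finrank ℂ (orbit s η ⊓ F : Submodule ℂ E))
      Nat.lt_wfRel.wf).has_min _ ⟨ξ, hξ.1, hξ.2⟩
  set p := (orbit s ξ).starProjection with hp
  have hpproj : IsStarProjection p := isStarProjection_starProjection
  have hps : ∀ A ∈ s, p * A = A * p := fun A hA => starProjection_orbit_comm hsmul hsstar ξ hA
  have hpN : p ∈ N := by
    rw [← N.commutant_commutant, VonNeumannAlgebra.mem_commutant_iff]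
    exact fun g hg => (hps g fun z hz _ =>
      (VonNeumannAlgebra.mem_commutant_iff.mp hg z hz).symm).symm
  have hpD : D * p = p * D := (hps D hDs).symm
  have hξmem : ξ ∈ orbit s ξ := apply_mem_orbit h1s ξ
  have hpmem : ∀ z, p z ∈ orbit s ξ := fun z => Submodule.starProjection_apply_mem _ _
  refine ⟨p, hpN, hpproj, fun hp0 => hξ0 ?_, hpD, fun z hz hzD => ?_⟩
  · rw [← Submodule.starProjection_eq_self_iff.mpr hξmem, ← hp, hp0]
    rfl
  set x := p * z * p with hx
  have hxN : x ∈ N := mul_mem (mul_mem hpN hz) hpN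
  have hxD : D * x = x * D := by
    rw [hx, ← mul_assoc, ← mul_assoc, hpD, mul_assoc p D z, hzD, ← mul_assoc, mul_assoc _ D p, hpD,
      ← mul_assoc]
  have hxp : x * p = x := by rw [hx, mul_assoc, hpproj.isIdempotentElem.eq]
  set W : Submodule ℂ E := orbit s ξ ⊓ F with hW
  have hWfin : FiniteDimensional ℂ W := Submodule.finiteDimensional_of_le inf_le_right
  have hWinv : ∀ w ∈ W, (x : E →ₗ[ℂ] E) w ∈ W := by
    rintro w ⟨-, hw⟩
    refine ⟨hpmem _, (hFmem _).mpr ?_⟩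
    have := DFunLike.congr_fun hxD w
    simp only [mul_apply_eq_comp, (hFmem w).mp hw, map_smul] at this
    exact this
  have hWnt : Nontrivial W := ⟨⟨⟨ξ, hξmem, hξF⟩, 0, fun h => hξ0 (congrArg Subtype.val h)⟩⟩
  obtain ⟨c, hcv⟩ := Module.End.exists_eigenvalue ((x : E →ₗ[ℂ] E).restrict hWinv)
  obtain ⟨⟨η, hηK, hηF⟩, hη, hη0⟩ := hcv.exists_hasEigenvector
  have hηx : x η = c • η := (congrArg Subtype.val (Module.End.mem_eigenspace_iff.mp hη))
  have hη0' : η ≠ 0 := fun h => hη0 (Subtype.ext h)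
  have hkill : ∀ ζ, x ζ = c • ζ → ∀ w ∈ orbit s ζ, x w = c • w := by
    intro ζ hζ
    have : orbit s ζ ≤ LinearMap.ker ((x - c • (1 : E →L[ℂ] E) : E →L[ℂ] E) : E →ₗ[ℂ] E) := by
      refine orbit_le (ContinuousLinearMap.isClosed_ker _) fun A hA => ?_
      have h1 : x (A ζ) = A (x ζ) := DFunLike.congr_fun ((hA x hxN hxD).symm) ζ
      simp [h1, hζ]
    intro w hw
    simpa [sub_eq_zero] using this hw
  have hle : (orbit s η ⊓ F : Submodule ℂ E) ≤ W :=
    inf_le_inf_right _ (orbit_le (isClosed_orbit _ _) fun A hA => orbit_invariant hsmul ξ hA η hηK)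
  have heq := Submodule.eq_of_le_of_finrank_le hle (not_lt.mp (hξmin η ⟨hηF, hη0'⟩))
  have hξη : ξ ∈ orbit s η := by
    have : ξ ∈ W := ⟨hξmem, hξF⟩
    rw [← heq] at this
    exact this.1
  have hξx := hkill ξ (hkill η hηx ξ hξη)
  refine ⟨c, ?_⟩
  ext w
  rw [← hxp]
  exact hξx (p w) (hpmem w)

end Slice

section SliceTypeI

variable {E : Type*} [NormedAddCommGroup E] [InnerProductSpace ℂ E] [CompleteSpace E]
  {ι : Type*} {b : HilbertBasis ι ℂ E} {M : VonNeumannAlgebra E} {x0 : E}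

theorem separating_commutant (hcyc : Cyclic M x0) : Separating M.commutant x0 := by
  intro A hA hA0
  refine ContinuousLinearMap.ext fun z => ?_
  refine hcyc.induction (P := fun z => A z = 0) ?_ ?_ z
  · rintro _ ⟨B, hB, rfl⟩
    have : B (A x0) = A (B x0) :=
      DFunLike.congr_fun (VonNeumannAlgebra.mem_commutant_iff.mp hA B hB) x0
    rw [← this, hA0, map_zero]
  · exact isClosed_eq A.continuous continuous_const

theorem inner_star_mul_self (A : E →L[ℂ] E) (x : E) : ⟪x, (star A * A) x⟫ = (‖A x‖ : ℂ) ^ 2 := by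
  rw [mul_apply_eq_comp, star_eq_adjoint, adjoint_inner_right, inner_self_eq_norm_sq_to_K]
  rfl

/-- An operator whose matrix coefficients against all eigenvectors of a compact self-adjoint
operator vanish is zero. -/
theorem eq_zero_of_eigenvectors {D : E →L[ℂ] E} (hc : IsCompactOperator D)
    (hD : IsSelfAdjoint D) {T : E →L[ℂ] E}
    (h : ∀ u v (α β : ℝ), D u = (α : ℂ) • u → D v = (β : ℂ) • v → ⟪u, T v⟫ = 0) : T = 0 := by
  have hsym : (D : E →ₗ[ℂ] E).IsSymmetric := hD.isSymmetric
  set K : Submodule ℂ E := ⨆ μ, Module.End.eigenspace (D : Module.End ℂ E) μ with hK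
  have hKbot : Kᗮ = ⊥ := orthogonalComplement_iSup_eigenspaces_eq_bot hc hsym
  have hKtop : K.topologicalClosure = ⊤ := Submodule.topologicalClosure_eq_top_iff.mpr hKbot
  have hreal : ∀ μ v, v ∈ Module.End.eigenspace (D : Module.End ℂ E) μ →
      ∃ α : ℝ, D v = (α : ℂ) • v := by
    intro μ v hv
    rcases eq_or_ne v 0 with rfl | hv0
    · exact ⟨0, by simp⟩
    have := hsym.conj_eigenvalue_eq_self
      (Module.End.hasEigenvalue_of_hasEigenvector ⟨hv, hv0⟩)
    obtain ⟨r, rfl⟩ := Complex.conj_eq_iff_real.mp this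
    exact ⟨r, Module.End.mem_eigenspace_iff.mp hv⟩
  have hT : ∀ μ v, v ∈ Module.End.eigenspace (D : Module.End ℂ E) μ → T v = 0 := by
    intro μ v hv
    obtain ⟨β, hβ⟩ := hreal μ v hv
    have : T v ∈ Kᗮ := by
      rw [hK, ← Submodule.iInf_orthogonal, Submodule.mem_iInf]
      intro ν
      rw [Submodule.mem_orthogonal]
      intro u hu
      obtain ⟨α, hα⟩ := hreal ν u hu
      exact h u v α β hα hβ
    simpa [hKbot] using this
  have hKT : K.topologicalClosure ≤ LinearMap.ker (T : E →ₗ[ℂ] E) :=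
    Submodule.topologicalClosure_minimal _ (iSup_le fun μ v hv => hT μ v hv)
      (ContinuousLinearMap.isClosed_ker T)
  ext z
  exact hKT (hKtop ▸ Submodule.mem_top)

variable {Φ Φst : (E →L[ℂ] E) →ₗ[ℂ] (E →L[ℂ] E)}

theorem IsSliceExtension.isTypeI (h : IsSliceExtension b M x0 Φ Φst) (hcyc : Cyclic M x0) :
    IsTypeI M := by
  have hsep := separating_commutant hcyc
  set D := Φst (rankOne x0 x0) with hDdef
  have hDsa : IsSelfAdjoint D := h.isSelfAdjoint_predual
  have hDc : IsCompactOperator D := h.isTraceClass_predual.isCompactOperator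
  obtain ⟨p, hpN, hp, hp0, hpD, hcorner⟩ :=
    exists_corner M.commutant hDc hDsa h.predual_ne_zero
  have hstarD : ∀ z, D * z = z * D → D * star z = star z * D := fun z hz => by
    have := congrArg star hz
    rw [star_mul, star_mul, hDsa.star_eq] at this
    exact this.symm
  have hvec : ∀ a ∈ M.commutant, (∀ Y, pairing b (Y * a) D = 0) → a = 0 := fun a ha h0 => by
    have h1 := h0 (star a)
    rw [h.pairing_predual, h.apply_of_mem (mul_mem (star_mem ha) ha), inner_star_mul_self] at h1
    exact hsep a ha (by simpa using h1)
  -- corners of slices of rank one operators built from eigenvectors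
  have hrank : ∀ u v (α β : ℝ), D u = (α : ℂ) • u → D v = (β : ℂ) • v → p u = u → p v = v →
      ∃ c : ℂ, Φ (rankOne v u) = c • p := by
    intro u v α β hu hv hpu hpv
    set a := Φ (rankOne v u) with ha
    have haN : a ∈ M.commutant := h.apply_mem _
    have hpap : p * a * p = a := by
      rw [ha, ← h.apply_mul_left _ hpN, ← h.apply_mul_right _ hpN]
      congr 1
      ext z
      simp only [rankOne, mul_apply_eq_comp, smulRight_apply, innerSL_apply_apply, map_smul, hpv]
      rw [← adjoint_inner_left, ← star_eq_adjoint, hp.isSelfAdjoint.star_eq, hpu]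
    have hap : a * p = a := by
      rw [← hpap, mul_assoc, hp.isIdempotentElem.eq]
    have hpa : p * a = a := by
      rw [← hpap, ← mul_assoc, ← mul_assoc, hp.isIdempotentElem.eq]
    have hpas : p * star a = star a := by
      have := congrArg star hap
      rwa [star_mul, hp.isSelfAdjoint.star_eq] at this
    have hasp : star a * p = star a := by
      have := congrArg star hpa
      rwa [star_mul, hp.isSelfAdjoint.star_eq] at this
    rcases eq_or_ne a 0 with h0 | h0
    · exact ⟨0, by rw [h0, zero_smul]⟩
    have hα : (α : ℂ) ≠ 0 := fun hα => h0 <| hvec a haN fun Y => by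
      rw [h.pairing_mul_predual' hu, hα, zero_mul]
    have hβ : (β : ℂ) ≠ 0 := fun hβ => h0 <| star_eq_zero.mp <| hvec _ (star_mem haN) fun Y => by
      have h1 := h.pairing_mul_predual (u := u) hv (star Y)
      have h2 := pairing_star_right b h.isTraceClass_predual (Y * star a)
      rw [← hDdef] at h1 h2
      rw [hDsa.star_eq, star_mul, star_star] at h2
      rw [h2, h1, hβ, zero_mul, map_zero]
    have h1 : (α : ℂ) • (D * a) = (β : ℂ) • (a * D) := h.smul_predual_mul hu hv
    have h2 : (α : ℂ) • (star a * D) = (β : ℂ) • (D * star a) := by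
      have := congrArg star h1
      simpa only [star_smul, star_mul, hDsa.star_eq, Complex.star_def, Complex.conj_ofReal]
        using this
    have h1' : D * a = ((β : ℂ) / α) • (a * D) := by
      rw [div_eq_inv_mul, mul_smul, ← h1, inv_smul_smul₀ hα]
    have h2' : D * star a = ((α : ℂ) / β) • (star a * D) := by
      rw [div_eq_inv_mul, mul_smul, h2, inv_smul_smul₀ hβ]
    have c1 : D * (star a * a) = (star a * a) * D := by
      rw [← mul_assoc, h2', smul_mul_assoc, mul_assoc, h1', mul_smul_comm, smul_smul,
        div_mul_div_cancel₀ hβ, div_self hα, one_smul, mul_assoc]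
    have c2 : D * (a * star a) = (a * star a) * D := by
      rw [← mul_assoc, h1', smul_mul_assoc, mul_assoc, h2', mul_smul_comm, smul_smul,
        div_mul_div_cancel₀ hα, div_self hβ, one_smul, mul_assoc]
    obtain ⟨t, ht⟩ := hcorner _ (mul_mem (star_mem haN) haN) c1
    obtain ⟨t', ht'⟩ := hcorner _ (mul_mem haN (star_mem haN)) c2
    rw [← mul_assoc, hpas, mul_assoc, hap] at ht
    rw [← mul_assoc, hpa, mul_assoc, hasp] at ht'
    have htt : t = t' := by
      refine smul_left_injective ℂ h0 ?_
      change t • a = t' • a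
      calc t • a = a * (t • p) := by rw [mul_smul_comm, hap]
        _ = a * star a * a := by rw [← ht, mul_assoc]
        _ = t' • a := by rw [ht', smul_mul_assoc, hpa]
    have e1 := h.pairing_mul_predual' (v := v) hu (star a)
    have e2 := h.pairing_mul_predual (u := u) hv (star a)
    rw [← ha, ht', ← htt, ← ht] at e2
    rw [← ha] at e1
    have hne : pairing b (star a * a) D ≠ 0 := by
      rw [h.pairing_predual, h.apply_of_mem (mul_mem (star_mem haN) haN), inner_star_mul_self]
      have : a x0 ≠ 0 := fun h' => h0 (hsep a haN h')
      simpa using this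
    have hX : ⟪u, Φ (star a) v⟫ ≠ 0 := by
      intro hX
      rw [hX, mul_zero] at e1
      exact hne e1
    have hαβ : (α : ℂ) = β := mul_right_cancel₀ hX (e1.symm.trans e2)
    rw [hαβ, div_self hβ, one_smul] at h1'
    obtain ⟨c, hc⟩ := hcorner a haN h1'
    exact ⟨c, hpap.symm.trans hc⟩
  obtain ⟨ξ, hpξ, hξ⟩ : ∃ ξ, p ξ = ξ ∧ ‖ξ‖ = 1 := by
    obtain ⟨w, hw⟩ : ∃ w, p w ≠ 0 := by
      by_contra! hcon
      exact hp0 (ContinuousLinearMap.ext hcon)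
    refine ⟨((‖p w‖ : ℂ)⁻¹) • p w, ?_, ?_⟩
    · rw [map_smul, ← mul_apply_eq_comp, hp.isIdempotentElem.eq]
    · rw [norm_smul, norm_inv, Complex.norm_real, norm_norm,
        inv_mul_cancel₀ (norm_ne_zero_iff.mpr hw)]
  have hpinner : ∀ x y, ⟪p x, y⟫ = ⟪x, p y⟫ := fun x y => by
    rw [← adjoint_inner_right, ← star_eq_adjoint, hp.isSelfAdjoint.star_eq]
  have hscalar : ∀ X, p * Φ X * p = ⟪ξ, Φ X ξ⟫ • p := by
    intro X
    ext z
    refine ext_inner_left ℂ fun w => ?_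
    set T := rankOne (p z) (p w) - ⟪w, p z⟫ • rankOne ξ ξ with hT
    have hTtr : IsTraceClass T :=
      (isTraceClass_rankOne _ _).sub ((isTraceClass_rankOne _ _).smul _)
    have hTpair : ∀ Z, pairing b Z T = ⟪p w, Z (p z)⟫ - ⟪w, p z⟫ * ⟪ξ, Z ξ⟫ := fun Z => by
      rw [hT, pairing_sub_right b (isTraceClass_rankOne _ _) ((isTraceClass_rankOne _ _).smul _),
        pairing_smul_right, pairing_rankOne, pairing_rankOne]
    have hzero : Φst T = 0 := by
      refine eq_zero_of_eigenvectors hDc hDsa fun u v α β hu hv => ?_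
      rw [← rankOne_pairing b (h.normal.1 _ hTtr), ← h.normal.2 _ _ hTtr, hTpair]
      have hpe : ∀ (u : E) (α : ℝ), D u = (α : ℂ) • u → D (p u) = (α : ℂ) • p u := by
        intro u α hu
        rw [← mul_apply_eq_comp, hpD, mul_apply_eq_comp, hu, map_smul]
      have hpp : ∀ u, p (p u) = p u := fun u => DFunLike.congr_fun hp.isIdempotentElem.eq u
      obtain ⟨c, hc⟩ := hrank (p u) (p v) α β (hpe u α hu) (hpe v β hv) (hpp u) (hpp v)
      have hR : rankOne (p v) (p u) = p * rankOne v u * p := by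
        ext z
        simp only [rankOne, mul_apply_eq_comp, smulRight_apply, innerSL_apply_apply, map_smul,
          hpinner]
      rw [hR, h.apply_mul_right _ hpN, h.apply_mul_left _ hpN] at hc
      have hcx : ∀ x y, ⟪p x, Φ (rankOne v u) (p y)⟫ = c * ⟪x, p y⟫ := fun x y => by
        rw [hpinner]
        have := DFunLike.congr_fun hc y
        simp only [mul_apply_eq_comp, smul_apply] at this
        rw [this, inner_smul_right]
      have h3 := hcx ξ ξ
      rw [hpξ, inner_self_eq_norm_sq_to_K, hξ] at h3
      rw [hcx, h3]
      simp [mul_comm]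
    have h4 := h.normal.2 X T hTtr
    rw [hzero, hTpair] at h4
    simp only [pairing, tr, comp_zero, zero_apply, inner_zero_right, tsum_zero] at h4
    simp only [mul_apply_eq_comp, smul_apply, inner_smul_right]
    rw [← hpinner, sub_eq_zero.mp h4, mul_comm]
  obtain ⟨q, hqM, hq, hq0, hqc⟩ := exists_isStarProjection_commutant hpN hp
    (fun x hx => ⟨⟪ξ, x ξ⟫, by have := hscalar x; rwa [h.apply_of_mem hx] at this⟩) hp0
  rw [M.commutant_commutant] at hqM hqc
  exact ⟨q, isMinimalProjection_of_corner hqM hq hq0 hqc⟩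

end SliceTypeI

section Corner

variable {E : Type*} [NormedAddCommGroup E] [InnerProductSpace ℂ E] [CompleteSpace E]
  {M : VonNeumannAlgebra E} {p : E →L[ℂ] E}

theorem mem_of_commute {X : E →L[ℂ] E} (h : ∀ T ∈ M.commutant, T * X = X * T) : X ∈ M := by
  rw [← M.commutant_commutant]
  exact VonNeumannAlgebra.mem_commutant_iff.mpr h

theorem mul_comm_of_mem_commutant {X T : E →L[ℂ] E} (hX : X ∈ M) (hT : T ∈ M.commutant) :
    X * T = T * X :=
  VonNeumannAlgebra.mem_commutant_iff.mp hT X hX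

theorem smul_mem_vonNeumannAlgebra (c : ℂ) {X : E →L[ℂ] E} (hX : X ∈ M) : c • X ∈ M :=
  M.toStarSubalgebra.smul_mem hX c

/-- The projection onto the kernel of an element of `M` belongs to `M`. -/
theorem starProjection_ker_mem {w : E →L[ℂ] E} (hw : w ∈ M) : w.ker.starProjection ∈ M := by
  refine mem_of_commute fun T hT => ?_
  have h : ∀ T ∈ M.commutant, ∀ x ∈ w.ker, T x ∈ w.ker := fun T hT x hx => by
    have h1 : w (T x) = T (w x) := DFunLike.congr_fun (mul_comm_of_mem_commutant hw hT) x
    have h2 : w x = 0 := hx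
    change w (T x) = 0
    rw [h1, h2, map_zero]
  exact (starProjection_mul_comm _ (h T hT) (h _ (star_mem hT))).symm

/-- A nonzero element of `M` vanishing on the kernel of a minimal projection `p` has the same
kernel as `p`. -/
theorem IsMinimalProjection.apply_eq_zero (hp : IsMinimalProjection M p) {w : E →L[ℂ] E}
    (hw : w ∈ M) (hker : ∀ z, p z = 0 → w z = 0) (h0 : w ≠ 0) {z : E} (hz : w z = 0) :
    p z = 0 := by
  obtain ⟨hpM, hpi, hps, -, hmin⟩ := hp
  set k := w.ker.starProjection with hk
  have hkM : k ∈ M := starProjection_ker_mem hw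
  have hkp : IsStarProjection k := isStarProjection_starProjection
  have hwk : ∀ x, w (k x) = 0 := fun x =>
    (Submodule.starProjection_apply_mem w.ker x : k x ∈ w.ker)
  have hpp : ∀ x, p (p x) = p x := fun x => DFunLike.congr_fun hpi.eq x
  have hrp : (1 - k) * p = 1 - k := by
    ext x
    have : k (x - p x) = x - p x := Submodule.starProjection_eq_self_iff.mpr
      (hker _ (by rw [map_sub, hpp, sub_self]))
    simp only [mul_apply_eq_comp, sub_apply, one_apply_eq_self]
    rw [map_sub] at this
    rw [sub_eq_sub_iff_sub_eq_sub, ← neg_sub x, ← this, neg_sub]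
  have hrs : IsSelfAdjoint (1 - k) := (IsSelfAdjoint.one _).sub hkp.isSelfAdjoint
  have hpr : p * (1 - k) = 1 - k := by
    have := congrArg star hrp
    rwa [star_mul, hrs.star_eq, hps.star_eq] at this
  have hr0 : (1 - k) ≠ 0 := by
    intro h
    refine h0 (ContinuousLinearMap.ext fun x => ?_)
    have hx : k x = x := by
      have : x - k x = 0 := DFunLike.congr_fun h x
      exact (sub_eq_zero.mp this).symm
    rw [← hx]
    exact hwk x
  have hrp' := hmin (1 - k) (sub_mem (one_mem M) hkM) hkp.isIdempotentElem.one_sub hrs hr0 hrp hpr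
  have : k z = z := Submodule.starProjection_eq_self_iff.mpr hz
  rw [← hrp', sub_apply, this]
  simp

theorem IsMinimalProjection.eq_zero_of_nonneg (hp : IsMinimalProjection M p) {w : E →L[ℂ] E}
    (hw : w ∈ M) (hker : ∀ z, p z = 0 → w z = 0) (hpos : 0 ≤ w) {ξ : E} (hξ : p ξ = ξ)
    (hξ0 : ξ ≠ 0) (h : ⟪ξ, w ξ⟫ = 0) : w = 0 := by
  by_contra h0
  obtain ⟨s, rfl⟩ := CStarAlgebra.nonneg_iff_eq_star_mul_self.mp hpos
  rw [inner_star_mul_self] at h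
  have hs : s ξ = 0 := by simpa using h
  refine hξ0 ?_
  rw [← hξ]
  exact hp.apply_eq_zero hw hker h0 (by rw [mul_apply_eq_comp, hs, map_zero])

theorem IsMinimalProjection.corner_selfAdjoint (hp : IsMinimalProjection M p) {ξ : E}
    (hξ : p ξ = ξ) (hξ1 : ‖ξ‖ = 1) {x : E →L[ℂ] E} (hx : x ∈ M) (hxs : IsSelfAdjoint x) :
    p * x * p = ⟪ξ, x ξ⟫ • p := by
  have hξ0 : ξ ≠ 0 := by
    rintro rfl
    simp at hξ1
  have hpM := hp.1
  have hpi := hp.2.1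
  have hps := hp.2.2.1
  set c := ⟪ξ, x ξ⟫ with hc
  have hcr : star c = c := by
    rw [hc, ← starRingEnd_apply, inner_conj_symm, ← adjoint_inner_right, ← star_eq_adjoint,
      hxs.star_eq]
  set y := p * x * p - c • p with hy
  have hyM : y ∈ M := sub_mem (mul_mem (mul_mem hpM hx) hpM) (smul_mem_vonNeumannAlgebra c hpM)
  have hys : star y = y := by
    simp [hy, hps.star_eq, hxs.star_eq, hcr, mul_assoc]
  have hyker : ∀ z, p z = 0 → y z = 0 := fun z hz => by simp [hy, hz]
  have hyξ : ⟪ξ, y ξ⟫ = 0 := by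
    have h1 : ⟪ξ, p (x ξ)⟫ = c := by
      rw [hc, ← adjoint_inner_left, ← star_eq_adjoint, hps.star_eq, hξ]
    simp [hy, hξ, h1, inner_self_eq_norm_sq_to_K, hξ1]
  have hysa : IsSelfAdjoint y := hys
  have hpos := CFC.posPart_sub_negPart y hysa
  have hpn : y⁺ * y⁻ = 0 := CFC.posPart_mul_negPart y
  have hp0 : 0 ≤ y⁺ := CFC.posPart_nonneg y
  have hn0 : 0 ≤ y⁻ := CFC.negPart_nonneg y
  have hpM' : y⁺ ∈ M := mem_of_commute fun T hT =>
    (Commute.cfcₙ_real (mul_comm_of_mem_commutant hyM hT) _).eq.symm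
  have hnM' : y⁻ ∈ M := mem_of_commute fun T hT =>
    (Commute.cfcₙ_real (mul_comm_of_mem_commutant hyM hT) _).eq.symm
  have hsq : ∀ w : E →L[ℂ] E, IsSelfAdjoint w → ∀ z, w (w z) = 0 → w z = 0 := fun w hw z hz => by
    have := inner_star_mul_self w z
    rw [hw.star_eq, mul_apply_eq_comp, hz, inner_zero_right] at this
    simpa using this.symm
  have hpker : ∀ z, p z = 0 → y⁺ z = 0 := fun z hz => by
    refine hsq _ hp0.isSelfAdjoint z ?_
    have h1 : y⁺ * y⁺ = y⁺ * y := by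
      have := congrArg (y⁺ * ·) hpos
      simpa only [mul_sub, hpn, sub_zero] using this
    have h2 : y⁺ (y⁺ z) = y⁺ (y z) := DFunLike.congr_fun h1 z
    rw [h2, hyker z hz, map_zero]
  have hnker : ∀ z, p z = 0 → y⁻ z = 0 := fun z hz => by
    have h2 : y⁺ z - y⁻ z = y z := DFunLike.congr_fun hpos z
    rw [hyker z hz, hpker z hz, zero_sub, neg_eq_zero] at h2
    exact h2
  have hor : y⁺ = 0 ∨ y⁻ = 0 := by
    by_contra! hcon
    refine hcon.2 ?_
    have h1 : p * y⁻ = 0 := by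
      ext z
      exact hp.apply_eq_zero hpM' hpker hcon.1 (DFunLike.congr_fun hpn z)
    have h2 : y⁻ = y⁻ * p := by
      ext z
      have : y⁻ (z - p z) = 0 := hnker _ (by
        rw [map_sub, ← mul_apply_eq_comp, hpi.eq, sub_self])
      rwa [map_sub, sub_eq_zero] at this
    have h3 := congrArg star h2
    rwa [star_mul, hn0.isSelfAdjoint.star_eq, hps.star_eq, h1] at h3
  have hin : ⟪ξ, y⁺ ξ⟫ - ⟪ξ, y⁻ ξ⟫ = 0 := by
    rw [← inner_sub_right, ← sub_apply, hpos, hyξ]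
  have hy0 : y = 0 := by
    rw [← hpos]
    rcases hor with h | h
    · have : y⁻ = 0 := hp.eq_zero_of_nonneg hnM' hnker hn0 hξ hξ0 (by simpa [h] using hin)
      rw [h, this, sub_zero]
    · have : y⁺ = 0 := hp.eq_zero_of_nonneg hpM' hpker hp0 hξ hξ0 (by simpa [h] using hin)
      rw [h, this, sub_zero]
  exact sub_eq_zero.mp hy0

theorem IsMinimalProjection.corner (hp : IsMinimalProjection M p) {x : E →L[ℂ] E} (hx : x ∈ M) :
    ∃ c : ℂ, p * x * p = c • p := by
  obtain ⟨ξ, hξ, hξ1⟩ : ∃ ξ, p ξ = ξ ∧ ‖ξ‖ = 1 := by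
    obtain ⟨v, hv⟩ : ∃ v, p v ≠ 0 := by
      by_contra! h
      exact hp.2.2.2.1 (ContinuousLinearMap.ext h)
    refine ⟨((‖p v‖⁻¹ : ℝ) : ℂ) • p v, ?_, ?_⟩
    · rw [map_smul, ← mul_apply_eq_comp, hp.2.1.eq]
    · rw [norm_smul, Complex.norm_real, norm_inv, norm_norm,
        inv_mul_cancel₀ (norm_ne_zero_iff.mpr hv)]
  have hre : (realPart x : E →L[ℂ] E) ∈ M := by
    rw [realPart_apply_coe]
    have := smul_mem_vonNeumannAlgebra (((2 : ℝ)⁻¹ : ℝ) : ℂ)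
      (add_mem hx (star_mem hx))
    rwa [Complex.coe_smul] at this
  have him : (imaginaryPart x : E →L[ℂ] E) ∈ M := by
    rw [imaginaryPart_apply_coe]
    have := smul_mem_vonNeumannAlgebra (((2 : ℝ)⁻¹ : ℝ) : ℂ)
      (sub_mem hx (star_mem hx))
    rw [Complex.coe_smul] at this
    exact smul_mem_vonNeumannAlgebra (-Complex.I) this
  have h1 := hp.corner_selfAdjoint hξ hξ1 hre (realPart x).2
  have h2 := hp.corner_selfAdjoint hξ hξ1 him (imaginaryPart x).2
  refine ⟨⟪ξ, (realPart x : E →L[ℂ] E) ξ⟫ + Complex.I * ⟪ξ, (imaginaryPart x : E →L[ℂ] E) ξ⟫, ?_⟩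
  conv_lhs => rw [← realPart_add_I_smul_imaginaryPart x]
  rw [mul_add, add_mul, mul_smul_comm, smul_mul_assoc, h1, h2, add_smul, smul_smul]

end Corner

section WeakLimits

open Filter Topology

variable {E : Type*} [NormedAddCommGroup E] [InnerProductSpace ℂ E] [CompleteSpace E]

theorem norm_le_of_inner_le {C : ℝ} (hC0 : 0 ≤ C) {T : E →L[ℂ] E}
    (h : ∀ y x, ‖⟪y, T x⟫‖ ≤ C * ‖y‖ * ‖x‖) : ‖T‖ ≤ C := by
  refine ContinuousLinearMap.opNorm_le_bound _ hC0 fun x => ?_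
  have := h (T x) x
  rw [inner_self_eq_norm_sq_to_K] at this
  rcases (norm_nonneg (T x)).eq_or_lt with h0 | h0
  · rw [← h0]; positivity
  · have h1 : ‖T x‖ * ‖T x‖ ≤ ‖T x‖ * (C * ‖x‖) := by
      calc ‖T x‖ * ‖T x‖ = ‖((‖T x‖ : ℝ) : ℂ) ^ 2‖ := by simp [pow_two]
        _ ≤ C * ‖T x‖ * ‖x‖ := this
        _ = _ := by ring
    exact le_of_mul_le_mul_left h1 h0

/-- A bounded sesquilinear form is implemented by a bounded operator. -/
theorem exists_operator_of_form {C : ℝ} (hC0 : 0 ≤ C) (L : E → E → ℂ)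
    (hadd₁ : ∀ y y' x, L (y + y') x = L y x + L y' x)
    (hsmul₁ : ∀ (c : ℂ) y x, L (c • y) x = starRingEnd ℂ c * L y x)
    (hadd₂ : ∀ y x x', L y (x + x') = L y x + L y x')
    (hsmul₂ : ∀ (c : ℂ) y x, L y (c • x) = c * L y x)
    (hbound : ∀ y x, ‖L y x‖ ≤ C * ‖y‖ * ‖x‖) :
    ∃ T : E →L[ℂ] E, ‖T‖ ≤ C ∧ ∀ y x, ⟪y, T x⟫ = L y x := by
  set B : E →L⋆[ℂ] E →L[ℂ] ℂ := LinearMap.mkContinuous₂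
    (LinearMap.mk₂'ₛₗ (starRingEnd ℂ) (RingHom.id ℂ) L hadd₁ hsmul₁ hadd₂ hsmul₂) C hbound with hB
  have hT : ∀ y x, ⟪y, star (InnerProductSpace.continuousLinearMapOfBilin B) x⟫ = L y x := by
    intro y x
    rw [star_eq_adjoint, adjoint_inner_right, InnerProductSpace.continuousLinearMapOfBilin_apply]
    rfl
  exact ⟨_, norm_le_of_inner_le hC0 fun y x => (hT y x).symm ▸ hbound y x, hT⟩

/-- Bounded families of operators converge weakly along ultrafilters. -/
theorem exists_tendsto_inner {α : Type*} (U : Ultrafilter α) (T : α → E →L[ℂ] E) {C : ℝ}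
    (hT : ∀ a, ‖T a‖ ≤ C) :
    ∃ T0 : E →L[ℂ] E, ‖T0‖ ≤ C ∧ ∀ y x, Tendsto (fun a => ⟪y, T a x⟫) U (𝓝 ⟪y, T0 x⟫) := by
  have hne : Nonempty α := U.neBot.nonempty
  have hC0 : 0 ≤ C := (norm_nonneg _).trans (hT hne.some)
  have hb : ∀ y x a, ‖⟪y, T a x⟫‖ ≤ C * ‖y‖ * ‖x‖ := fun y x a =>
    calc ‖⟪y, T a x⟫‖ ≤ ‖y‖ * ‖T a x‖ := norm_inner_le_norm _ _
      _ ≤ ‖y‖ * (C * ‖x‖) := by gcongr; exact (T a).le_of_opNorm_le (hT a) x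
      _ = _ := by ring
  have hex : ∀ y x, ∃ z ∈ Metric.closedBall (0 : ℂ) (C * ‖y‖ * ‖x‖),
      Tendsto (fun a => ⟪y, T a x⟫) U (𝓝 z) := fun y x =>
    (isCompact_closedBall (0 : ℂ) (C * ‖y‖ * ‖x‖)).ultrafilter_le_nhds'
      (U.map fun a => ⟪y, T a x⟫) (Filter.mem_map.mpr <| Filter.Eventually.of_forall fun a => by
        simpa using hb y x a)
  choose L hL hlim using hex
  obtain ⟨T0, h1, h2⟩ := exists_operator_of_form hC0 L
    (fun y y' x => tendsto_nhds_unique (hlim _ _) (by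
      simpa only [inner_add_left] using (hlim y x).add (hlim y' x)))
    (fun c y x => tendsto_nhds_unique (hlim _ _) (by
      simpa only [inner_smul_left] using (hlim y x).const_mul _))
    (fun y x x' => tendsto_nhds_unique (hlim _ _) (by
      simpa only [map_add, inner_add_right] using (hlim y x).add (hlim y x')))
    (fun c y x => tendsto_nhds_unique (hlim _ _) (by
      simpa only [map_smul, inner_smul_right] using (hlim y x).const_mul _))
    (fun y x => by simpa using hL y x)
  exact ⟨T0, h1, fun y x => by rw [h2]; exact hlim y x⟩

/-- Uniformly bounded families of linear maps on operators converge pointwise weakly along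
ultrafilters. -/
theorem exists_tendsto_inner_map {α : Type*} (U : Ultrafilter α)
    (Ψ : α → (E →L[ℂ] E) →ₗ[ℂ] (E →L[ℂ] E)) {C : ℝ} (hΨ : ∀ a X, ‖Ψ a X‖ ≤ C * ‖X‖) :
    ∃ Ψ0 : (E →L[ℂ] E) →ₗ[ℂ] (E →L[ℂ] E), (∀ X, ‖Ψ0 X‖ ≤ C * ‖X‖) ∧
      ∀ X y x, Tendsto (fun a => ⟪y, Ψ a X x⟫) U (𝓝 ⟪y, Ψ0 X x⟫) := by
  choose Ψ0 h1 h2 using fun X => exists_tendsto_inner U (fun a => Ψ a X) (fun a => hΨ a X)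
  have hext : ∀ S T : E →L[ℂ] E, (∀ y x, ⟪y, S x⟫ = ⟪y, T x⟫) → S = T := fun S T h =>
    ContinuousLinearMap.ext fun x => ext_inner_left ℂ fun y => h y x
  refine ⟨⟨⟨Ψ0, fun X Y => ?_⟩, fun c X => ?_⟩, h1, h2⟩
  · refine hext _ _ fun y x => tendsto_nhds_unique (h2 _ _ _) ?_
    simpa only [map_add, add_apply, inner_add_right] using (h2 X y x).add (h2 Y y x)
  · refine hext _ _ fun y x => tendsto_nhds_unique (h2 _ _ _) ?_
    simpa only [map_smul, smul_apply, inner_smul_right, RingHom.id_apply] using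
      (h2 X y x).const_mul _

end WeakLimits

section Polar

open Filter Topology

variable {E : Type*} [NormedAddCommGroup E] [InnerProductSpace ℂ E] [CompleteSpace E]

/-- Polar decomposition. -/
theorem exists_polar (S : E →L[ℂ] E) : ∃ A T : E →L[ℂ] E, 0 ≤ A ∧ ‖T‖ ≤ 1 ∧ T * A = S ∧
    star T * S = A := by
  set A := CFC.abs S with hA
  have hA0 : 0 ≤ A := CFC.abs_nonneg S
  have hAs : star A = A := hA0.isSelfAdjoint.star_eq
  have hAA : A * A = star S * S := CFC.abs_mul_abs S
  have hnorm : ∀ x, ‖S x‖ = ‖A x‖ := fun x => by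
    have h1 := inner_star_mul_self S x
    have h2 := inner_star_mul_self A x
    rw [hAs, hAA, h1] at h2
    have h3 : ‖S x‖ ^ 2 = ‖A x‖ ^ 2 := by exact_mod_cast h2
    exact (sq_eq_sq₀ (norm_nonneg _) (norm_nonneg _)).mp h3
  set ε : ℕ → ℝ := fun n => 1 / ((n : ℝ) + 1) with hε
  have hε0 : ∀ n, 0 < ε n := fun n => by positivity
  have hunit : ∀ n, ∃ G : E →L[ℂ] E, (A + (ε n : ℂ) • 1) * G = 1 ∧ G * (A + (ε n : ℂ) • 1) = 1 := by
    intro n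
    have hpos : IsStrictlyPositive ((ε n : ℂ) • (1 : E →L[ℂ] E)) := by
      have : IsStrictlyPositive (ε n • (1 : E →L[ℂ] E)) :=
        IsStrictlyPositive.smul (hε0 n) isStrictlyPositive_one
      rwa [← Complex.coe_smul] at this
    have hu : IsUnit (A + (ε n : ℂ) • (1 : E →L[ℂ] E)) := by
      rw [add_comm]
      exact (hpos.add_nonneg hA0).isUnit
    exact ⟨↑hu.unit⁻¹, hu.mul_val_inv, hu.val_inv_mul⟩
  choose G hG1 hG2 using hunit
  have hre : ∀ x, 0 ≤ (⟪A x, x⟫).re := fun x => by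
    obtain ⟨s, hs⟩ := CStarAlgebra.nonneg_iff_eq_star_mul_self.mp hA0
    have h1 := inner_star_mul_self s x
    rw [← hs] at h1
    rw [← adjoint_inner_right, ← star_eq_adjoint, hAs, h1]
    exact_mod_cast sq_nonneg ‖s x‖
  have hlow : ∀ n x, ‖A x‖ ≤ ‖A x + (ε n : ℂ) • x‖ := fun n x => by
    refine le_of_sq_le_sq ?_ (norm_nonneg _)
    rw [@norm_add_sq ℂ, inner_smul_right]
    have : 0 ≤ RCLike.re ((ε n : ℂ) * ⟪A x, x⟫) := by
      simp only [RCLike.re_to_complex, Complex.re_ofReal_mul]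
      exact mul_nonneg (hε0 n).le (hre x)
    nlinarith [sq_nonneg ‖(ε n : ℂ) • x‖]
  have hAG : ∀ n x, ‖A (G n x)‖ ≤ ‖x‖ := fun n x => by
    refine (hlow n (G n x)).trans (le_of_eq ?_)
    have : (A + (ε n : ℂ) • (1 : E →L[ℂ] E)) (G n x) = x := DFunLike.congr_fun (hG1 n) x
    simpa using congrArg norm this
  have hbd : ∀ n, ‖S * G n‖ ≤ 1 := fun n =>
    ContinuousLinearMap.opNorm_le_bound _ zero_le_one fun x => by
      rw [mul_apply_eq_comp, hnorm, one_mul]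
      exact hAG n x
  obtain ⟨T, hT1, hT2⟩ := exists_tendsto_inner (Ultrafilter.of (atTop : Filter ℕ))
    (fun n => S * G n) hbd
  have hε_lim : Tendsto (fun n => (ε n : ℂ)) (Ultrafilter.of (atTop : Filter ℕ)) (𝓝 0) := by
    have : Tendsto (fun n => (ε n : ℂ)) atTop (𝓝 ((0 : ℝ) : ℂ)) :=
      (Complex.continuous_ofReal.tendsto 0).comp tendsto_one_div_add_atTop_nhds_zero_nat
    simpa using this.mono_left (Ultrafilter.of_le _)
  have hGA : ∀ n x, G n (A x) = x - (ε n : ℂ) • G n x := fun n x => by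
    have h1 : G n (A x + (ε n : ℂ) • x) = x := DFunLike.congr_fun (hG2 n) x
    rw [map_add, map_smul] at h1
    exact eq_sub_of_add_eq h1
  have hGA' : ∀ n x, A (G n x) = x - (ε n : ℂ) • G n x := fun n x => by
    have h1 : A (G n x) + (ε n : ℂ) • G n x = x := DFunLike.congr_fun (hG1 n) x
    exact eq_sub_of_add_eq h1
  have hcomm : ∀ n x, A (G n x) = G n (A x) := fun n x => by rw [hGA, hGA']
  have hlim0 : ∀ y x, Tendsto (fun n => (ε n : ℂ) * ⟪y, (S * G n) x⟫)
      (Ultrafilter.of (atTop : Filter ℕ)) (𝓝 0) := fun y x => by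
    simpa using hε_lim.mul (hT2 y x)
  refine ⟨A, T, hA0, hT1, ?_, ?_⟩
  · refine ContinuousLinearMap.ext fun x => ext_inner_left ℂ fun y => ?_
    refine tendsto_nhds_unique (hT2 y (A x)) ?_
    have : ∀ n, ⟪y, (S * G n) (A x)⟫ = ⟪y, S x⟫ - (ε n : ℂ) * ⟪y, (S * G n) x⟫ := fun n => by
      rw [mul_apply_eq_comp, hGA, map_sub, map_smul, inner_sub_right, inner_smul_right]
      rfl
    simp only [this]
    simpa using tendsto_const_nhds.sub (hlim0 y x)
  · refine ContinuousLinearMap.ext fun x => ext_inner_right ℂ fun y => ?_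
    rw [mul_apply_eq_comp, star_eq_adjoint, adjoint_inner_left]
    refine tendsto_nhds_unique (hT2 (S x) y) ?_
    have h1 : ∀ z, ⟪S x, S z⟫ = ⟪A x, A z⟫ := fun z => by
      have : star S (S x) = A (A x) := DFunLike.congr_fun hAA.symm x
      rw [← adjoint_inner_left, ← star_eq_adjoint, this, ← adjoint_inner_left,
        ← star_eq_adjoint, hAs]
    have h2 : ∀ n, ⟪S x, (S * G n) y⟫ = ⟪A x, y⟫ - (ε n : ℂ) * ⟪A x, G n y⟫ := fun n => by
      rw [mul_apply_eq_comp, h1, hGA', inner_sub_right, inner_smul_right]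
    have h3 : Tendsto (fun n => (ε n : ℂ) * ⟪A x, G n y⟫) (Ultrafilter.of (atTop : Filter ℕ))
        (𝓝 0) := by
      refine squeeze_zero_norm (a := fun n => ‖(ε n : ℂ)‖ * (‖x‖ * ‖y‖)) (fun n => ?_) ?_
      · rw [norm_mul]
        gcongr
        rw [← adjoint_inner_right, ← star_eq_adjoint, hAs]
        exact (norm_inner_le_norm _ _).trans (by gcongr; exact hAG n y)
      · simpa using hε_lim.norm.mul_const (‖x‖ * ‖y‖)
    simp only [h2]
    simpa using tendsto_const_nhds.sub h3

end Polar

section Normality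

open Filter Topology

variable {E : Type*} [NormedAddCommGroup E] [InnerProductSpace ℂ E] [CompleteSpace E]
  {ι : Type*}

theorem norm_sum_rankOne_le (b : HilbertBasis ι ℂ E) (T : E →L[ℂ] E) (s : Finset ι) :
    ‖∑ i ∈ s, rankOne (b i) (T (b i))‖ ≤ ‖T‖ := by
  refine ContinuousLinearMap.opNorm_le_bound _ (norm_nonneg _) fun z => ?_
  have h1 : (∑ i ∈ s, rankOne (b i) (T (b i))) z = ∑ i ∈ s, ⟪b i, star T z⟫ • b i := by
    rw [sum_apply]
    refine Finset.sum_congr rfl fun i _ => ?_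
    rw [star_eq_adjoint, adjoint_inner_right]
    rfl
  have h2 : ‖∑ i ∈ s, ⟪b i, star T z⟫ • b i‖ ^ 2 = ∑ i ∈ s, ‖⟪b i, star T z⟫‖ ^ 2 := by
    have := b.orthonormal.inner_sum (fun i => ⟪b i, star T z⟫) (fun i => ⟪b i, star T z⟫) s
    have h4 : ∀ v : E, ⟪v, v⟫ = ((‖v‖ ^ 2 : ℝ) : ℂ) := fun v => by
      rw [inner_self_eq_norm_sq_to_K]; push_cast; rfl
    rw [h4] at this
    have h3 : ∀ c : ℂ, starRingEnd ℂ c * c = ((‖c‖ ^ 2 : ℝ) : ℂ) := fun c => by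
      rw [Complex.conj_mul']; push_cast; rfl
    simp only [h3] at this
    exact_mod_cast this
  rw [h1]
  have h3 : ‖∑ i ∈ s, ⟪b i, star T z⟫ • b i‖ ≤ ‖star T z‖ := by
    refine le_of_sq_le_sq ?_ (norm_nonneg _)
    rw [h2]
    exact bessel_hilbertBasis b _ s
  refine h3.trans (((star T).le_opNorm z).trans (le_of_eq ?_))
  rw [norm_star]

/-- An operator implementing a bounded functional on rank one operators is of trace class. -/
theorem isTraceClass_of_functional (b : HilbertBasis ι ℂ E) {S : E →L[ℂ] E}
    (f : (E →L[ℂ] E) →ₗ[ℂ] ℂ) {C : ℝ} (hC0 : 0 ≤ C)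
    (hf : ∀ X, ‖f X‖ ≤ C * ‖X‖) (hS : ∀ x y, f (rankOne x y) = ⟪y, S x⟫) : IsTraceClass S := by
  obtain ⟨A, T, hA0, hT1, hTA, hTS⟩ := exists_polar S
  have hAs : star A = A := hA0.isSelfAdjoint.star_eq
  set R := CFC.sqrt A with hR
  have hRR : R * R = A := CFC.sqrt_mul_sqrt_self A hA0
  have hRs : star R = R := (CFC.sqrt_nonneg A).isSelfAdjoint.star_eq
  have hsq : ∀ i, ((‖R (b i)‖ ^ 2 : ℝ) : ℂ) = f (rankOne (b i) (T (b i))) := fun i => by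
    rw [hS, ← adjoint_inner_right, ← star_eq_adjoint, ← mul_apply_eq_comp, hTS, ← hRR]
    have := inner_star_mul_self R (b i)
    rw [hRs] at this
    rw [this]
    push_cast
    rfl
  have hsum : Summable fun i => ‖R (b i)‖ ^ 2 := by
    refine summable_of_sum_le (c := C) (fun i => sq_nonneg _) fun s => ?_
    have h1 : ((∑ i ∈ s, ‖R (b i)‖ ^ 2 : ℝ) : ℂ) = f (∑ i ∈ s, rankOne (b i) (T (b i))) := by
      rw [map_sum]
      push_cast
      refine Finset.sum_congr rfl fun i _ => ?_
      rw [← hsq]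
      push_cast
      rfl
    have h2 : ‖((∑ i ∈ s, ‖R (b i)‖ ^ 2 : ℝ) : ℂ)‖ = ∑ i ∈ s, ‖R (b i)‖ ^ 2 := by
      rw [Complex.norm_real, Real.norm_of_nonneg (Finset.sum_nonneg fun i _ => sq_nonneg _)]
    rw [← h2, h1]
    refine (hf _).trans ?_
    calc C * _ ≤ C * 1 := by
          gcongr
          exact (norm_sum_rankOne_le b T s).trans hT1
      _ = C := mul_one C
  refine isTraceClass_of_nuclear (x := fun i => T (R (b i))) (y := fun i => R (b i)) ?_ fun z => ?_
  · refine Summable.of_nonneg_of_le (fun i => by positivity) (fun i => ?_) hsum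
    calc ‖T (R (b i))‖ * ‖R (b i)‖ ≤ (1 * ‖R (b i)‖) * ‖R (b i)‖ := by
          gcongr; exact T.le_of_opNorm_le hT1 _
      _ = _ := by ring
  · have h1 : S z = T (R (R z)) := by
      rw [← hTA, ← hRR]; rfl
    have h2 := (T ∘L R).hasSum (b.hasSum_repr (R z))
    rw [h1]
    refine (h2.tsum_eq.symm.trans (tsum_congr fun i => ?_))
    rw [map_smul, b.repr_apply_apply]
    congr 1
    rw [← adjoint_inner_left, ← star_eq_adjoint, hRs]

theorem mul_rankOne_mul (P Q : E →L[ℂ] E) (x y : E) :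
    P * rankOne x y * star Q = rankOne (P x) (Q y) := by
  ext z
  simp [rankOne, star_eq_adjoint, adjoint_inner_right]

theorem rankOne_add_left (x x' y : E) : rankOne (x + x') y = rankOne x y + rankOne x' y := by
  ext z; simp [rankOne]

theorem rankOne_add_right (x y y' : E) : rankOne x (y + y') = rankOne x y + rankOne x y' := by
  ext z; simp [rankOne, add_smul]

theorem rankOne_smul_left (c : ℂ) (x y : E) : rankOne (c • x) y = c • rankOne x y := by
  ext z; simp [rankOne, smul_comm c]

theorem rankOne_smul_right (c : ℂ) (x y : E) :
    rankOne x (c • y) = starRingEnd ℂ c • rankOne x y := by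
  ext z; simp [rankOne, mul_smul]

theorem norm_rankOne_le (x y : E) : ‖rankOne x y‖ ≤ ‖x‖ * ‖y‖ := by
  refine ContinuousLinearMap.opNorm_le_bound _ (by positivity) fun z => ?_
  simp only [rankOne, smulRight_apply, innerSL_apply_apply, norm_smul]
  calc ‖⟪y, z⟫‖ * ‖x‖ ≤ (‖y‖ * ‖z‖) * ‖x‖ := by gcongr; exact norm_inner_le_norm _ _
    _ = _ := by ring

/-- A bounded functional on operators whose compressions along a net of contractions increasing
to the identity are normal and approximate it is normal. -/
theorem exists_pairing_eq_of_tendsto (b : HilbertBasis ι ℂ E) {α : Type*} {l : Filter α} [l.NeBot]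
    {P : α → E →L[ℂ] E} (hPs : ∀ a, star (P a) = P a) (hP1 : ∀ a, ‖P a‖ ≤ 1)
    (hP : ∀ x, Tendsto (fun a => P a x) l (𝓝 x))
    (f : (E →L[ℂ] E) →ₗ[ℂ] ℂ) {C : ℝ} (hC0 : 0 ≤ C) (hf : ∀ X, ‖f X‖ ≤ C * ‖X‖)
    (hlim : ∀ X, Tendsto (fun a => f (P a * X * P a)) l (𝓝 (f X)))
    (hnormal : ∀ a, ∃ S, IsTraceClass S ∧ ∀ X, f (P a * X * P a) = pairing b X S) :
    ∃ S, IsTraceClass S ∧ ∀ X, f X = pairing b X S := by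
  obtain ⟨S, -, hS⟩ := exists_operator_of_form hC0 (fun y x => f (rankOne x y))
    (fun y y' x => by rw [rankOne_add_right, map_add])
    (fun c y x => by rw [rankOne_smul_right, map_smul, smul_eq_mul])
    (fun y x x' => by rw [rankOne_add_left, map_add])
    (fun c y x => by rw [rankOne_smul_left, map_smul, smul_eq_mul])
    (fun y x => (hf _).trans (by
      calc C * ‖rankOne x y‖ ≤ C * (‖x‖ * ‖y‖) := by gcongr; exact norm_rankOne_le x y
        _ = _ := by ring))
  have hST := isTraceClass_of_functional b f hC0 hf fun x y => (hS y x).symm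
  refine ⟨S, hST, fun X => ?_⟩
  choose S' hS' hS'f using hnormal
  have hSeq : ∀ a, S' a = P a * S * P a := fun a => by
    refine ContinuousLinearMap.ext fun x => ext_inner_left ℂ fun y => ?_
    rw [← rankOne_pairing b (hS' a), ← hS'f]
    have : P a * rankOne x y * P a = rankOne (P a x) (P a y) := by
      rw [← mul_rankOne_mul, hPs]
    rw [this, ← hS, ← adjoint_inner_right, ← star_eq_adjoint, hPs]
    rfl
  refine tendsto_nhds_unique (hlim X) ?_
  obtain ⟨x, y, hs, hT⟩ := hST
  have hcomp : ∀ a, f (P a * X * P a) = ∑' n, ⟪P a (y n), X (P a (x n))⟫ := fun a => by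
    rw [hS'f, hSeq, mul_assoc, pairing_mul_left, pairing_mul_right b ⟨x, y, hs, hT⟩,
      pairing_eq_tsum b hs hT]
    refine tsum_congr fun n => ?_
    conv_rhs => rw [← adjoint_inner_right, ← star_eq_adjoint, hPs]
    rfl
  simp only [hcomp]
  rw [pairing_eq_tsum b hs hT]
  refine tendsto_tsum_of_dominated_convergence (hs.mul_left ‖X‖) (fun n => ?_)
    (Eventually.of_forall fun a n => ?_)
  · exact (hP (y n)).inner ((X.continuous.tendsto _).comp (hP (x n)))
  · have h1 : ∀ z, ‖P a z‖ ≤ ‖z‖ := fun z => by simpa using (P a).le_of_opNorm_le (hP1 a) z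
    calc ‖⟪P a (y n), X (P a (x n))⟫‖ ≤ ‖P a (y n)‖ * ‖X (P a (x n))‖ := norm_inner_le_norm _ _
      _ ≤ ‖y n‖ * (‖X‖ * ‖x n‖) := by
        gcongr
        · exact h1 _
        · exact (X.le_opNorm _).trans (by gcongr; exact h1 _)
      _ = _ := by ring

/-- A linear map all of whose normal functionals pull back to normal functionals has a predual. -/
theorem exists_isNormalPair (b : HilbertBasis ι ℂ E) (Φ : (E →L[ℂ] E) →ₗ[ℂ] (E →L[ℂ] E))
    (h : ∀ T, IsTraceClass T → ∃ S, IsTraceClass S ∧ ∀ X, pairing b (Φ X) T = pairing b X S) :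
    ∃ Φst, IsNormalPair b Φ Φst := by
  choose! F hF hFp using h
  have huniq : ∀ S T, IsTraceClass S → IsTraceClass T →
      (∀ X, pairing b X S = pairing b X T) → S = T := fun S T hS hT hST =>
    ContinuousLinearMap.ext fun u => ext_inner_left ℂ fun v => by
      rw [← rankOne_pairing b hS, hST, rankOne_pairing b hT]
  let g : traceClassSubmodule E →ₗ[ℂ] (E →L[ℂ] E) :=
    { toFun := fun T => F T
      map_add' := fun S T => huniq _ _ (hF _ (S + T).2) ((hF _ S.2).add (hF _ T.2)) fun X => by
        rw [← hFp _ (S + T).2, pairing_add_right b (hF _ S.2) (hF _ T.2), ← hFp _ S.2,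
          ← hFp _ T.2, ← pairing_add_right b S.2 T.2]
        rfl
      map_smul' := fun c T => huniq _ _ (hF _ (c • T).2) ((hF _ T.2).smul c) fun X => by
        rw [← hFp _ (c • T).2, RingHom.id_apply, pairing_smul_right, ← hFp _ T.2,
          ← pairing_smul_right]
        rfl }
  obtain ⟨Φst, hΦ⟩ := LinearMap.exists_extend g
  have hval : ∀ T, IsTraceClass T → Φst T = F T := fun T hT => DFunLike.congr_fun hΦ ⟨T, hT⟩
  exact ⟨Φst, fun T hT => by rw [hval T hT]; exact hF T hT,
    fun X T hT => by rw [hval T hT]; exact hFp T hT X⟩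

end Normality

section MatrixUnits

open Filter Topology

variable {E : Type*} [NormedAddCommGroup E] [InnerProductSpace ℂ E] [CompleteSpace E]

/-- The first column `v j = e_{j1}` of a system of matrix units with `e_{11} = q`. -/
structure IsUnitColumn {J : Type*} (q : E →L[ℂ] E) (v : J → E →L[ℂ] E) : Prop where
  proj : IsStarProjection q
  star_mul_self : ∀ j, star (v j) * v j = q
  star_mul_of_ne : ∀ i j, i ≠ j → star (v i) * v j = 0
  total : ∀ z, (∀ j, star (v j) z = 0) → z = 0

/-- The closed subspace spanned by the ranges of a set of operators. -/
def jointRange (s : Set (E →L[ℂ] E)) : Submodule ℂ E :=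
  (Submodule.span ℂ {x | ∃ A ∈ s, ∃ z, A z = x}).topologicalClosure

theorem isClosed_jointRange (s : Set (E →L[ℂ] E)) : IsClosed (jointRange s : Set E) :=
  Submodule.isClosed_topologicalClosure _

instance (s : Set (E →L[ℂ] E)) : CompleteSpace (jointRange s) :=
  (isClosed_jointRange s).completeSpace_coe

theorem apply_mem_jointRange {s : Set (E →L[ℂ] E)} {A : E →L[ℂ] E} (hA : A ∈ s) (z : E) :
    A z ∈ jointRange s :=
  Submodule.le_topologicalClosure _ (Submodule.subset_span ⟨A, hA, z, rfl⟩)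

theorem jointRange_le {s : Set (E →L[ℂ] E)} {K : Submodule ℂ E} (hK : IsClosed (K : Set E))
    (h : ∀ A ∈ s, ∀ z, A z ∈ K) : jointRange s ≤ K :=
  Submodule.topologicalClosure_minimal _
    (Submodule.span_le.mpr (by rintro _ ⟨A, hA, z, rfl⟩; exact h A hA z)) hK

theorem jointRange_invariant {s : Set (E →L[ℂ] E)} {X : E →L[ℂ] E}
    (h : ∀ A ∈ s, ∀ z, X (A z) ∈ jointRange s) : ∀ x ∈ jointRange s, X x ∈ jointRange s := by
  have : jointRange s ≤ (jointRange s).comap (X : E →ₗ[ℂ] E) :=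
    jointRange_le ((isClosed_jointRange s).preimage X.continuous) h
  exact this

theorem starProjection_jointRange_eq_zero {s : Set (E →L[ℂ] E)} {z : E}
    (h : ∀ A ∈ s, star A z = 0) : (jointRange s).starProjection z = 0 := by
  rw [Submodule.starProjection_apply_eq_zero_iff]
  have : jointRange s ≤ (Submodule.span ℂ {z})ᗮ := by
    refine jointRange_le (Submodule.isClosed_orthogonal _) fun A hA x => ?_
    rw [Submodule.mem_orthogonal_singleton_iff_inner_left, ← adjoint_inner_right,
      ← star_eq_adjoint, h A hA, inner_zero_right]
  rw [Submodule.mem_orthogonal]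
  intro u hu
  exact Submodule.mem_orthogonal_singleton_iff_inner_left.mp (this hu)

theorem exists_isUnitColumn {M : VonNeumannAlgebra E} (hM : IsFactor M) {q : E →L[ℂ] E}
    (hqN : q ∈ M.commutant) (hq : IsStarProjection q) (hq0 : q ≠ 0)
    (hcorner : ∀ T ∈ M.commutant, ∃ c : ℂ, q * T * q = c • q) :
    ∃ J : Set (E →L[ℂ] E), (∀ v ∈ J, v ∈ M.commutant) ∧
      IsUnitColumn q (fun v : J => (v : E →L[ℂ] E)) := by
  set S : Set (Set (E →L[ℂ] E)) := {J | (∀ v ∈ J, v ∈ M.commutant ∧ star v * v = q) ∧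
    ∀ v ∈ J, ∀ w ∈ J, v ≠ w → star v * w = 0} with hSdef
  obtain ⟨J, hJ⟩ := zorn_subset S (fun c hc hchain => by
    refine ⟨⋃₀ c, ⟨?_, ?_⟩, fun s hs => Set.subset_sUnion_of_mem hs⟩
    · rintro v ⟨s, hs, hv⟩
      exact (hc hs).1 v hv
    · rintro v ⟨s, hs, hv⟩ w ⟨t, ht, hw⟩ hvw
      rcases hchain.total hs ht with hst | hst
      · exact (hc ht).2 v (hst hv) w hw hvw
      · exact (hc hs).2 v hv w (hst hw) hvw)
  have hJS : J ∈ S := hJ.prop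
  refine ⟨J, fun v hv => (hJS.1 v hv).1, hq, fun v => (hJS.1 v v.2).2,
    fun v w hvw => hJS.2 v v.2 w w.2 (fun h => hvw (Subtype.ext h)), fun z hz => ?_⟩
  set e := (jointRange J).starProjection with he
  have hMinv : ∀ X ∈ M, ∀ x ∈ jointRange J, X x ∈ jointRange J := fun X hX =>
    jointRange_invariant fun A hA z => by
      have : X (A z) = A (X z) := DFunLike.congr_fun (mul_comm_of_mem_commutant hX (hJS.1 A hA).1) z
      rw [this]
      exact apply_mem_jointRange hA _
  have heN : e ∈ M.commutant := VonNeumannAlgebra.mem_commutant_iff.mpr fun X hX =>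
    (starProjection_mul_comm _ (hMinv X hX) (hMinv _ (star_mem hX))).symm
  have heP : IsStarProjection e := isStarProjection_starProjection
  have hev : ∀ w ∈ J, e * w = w := fun w hw => ContinuousLinearMap.ext fun x =>
    Submodule.starProjection_eq_self_iff.mpr (apply_mem_jointRange hw x)
  have hzero : ∀ u ∈ M.commutant, (1 - e) * u * q = 0 := by
    intro u hu
    by_contra ht
    set t := (1 - e) * u * q with htdef
    have htN : t ∈ M.commutant := mul_mem (mul_mem (sub_mem (one_mem _) heN) hu) hqN
    have het : e * t = 0 := by
      rw [htdef, ← mul_assoc, ← mul_assoc, mul_sub, mul_one, heP.isIdempotentElem.eq, sub_self,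
        zero_mul, zero_mul]
    obtain ⟨c, hc⟩ := hcorner (star u * (1 - e) * u)
      (mul_mem (mul_mem (star_mem hu) (sub_mem (one_mem _) heN)) hu)
    have htt : star t * t = c • q := by
      rw [← hc, htdef]
      simp only [star_mul, heP.one_sub.isSelfAdjoint.star_eq, hq.isSelfAdjoint.star_eq]
      have h1 := heP.one_sub.isIdempotentElem.eq
      calc q * (star u * (1 - e)) * ((1 - e) * u * q)
          = q * (star u * ((1 - e) * (1 - e)) * u) * q := by simp only [mul_assoc]
        _ = _ := by rw [h1]
    obtain ⟨x, hx⟩ : ∃ x, t x ≠ 0 := by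
      by_contra! h
      exact ht (ContinuousLinearMap.ext h)
    have hqq : star q * q = q := by rw [hq.isSelfAdjoint.star_eq, hq.isIdempotentElem.eq]
    have hnorm : (‖t x‖ : ℂ) ^ 2 = c * (‖q x‖ : ℂ) ^ 2 := by
      rw [← inner_star_mul_self, htt, ← inner_star_mul_self, hqq, smul_apply, inner_smul_right]
    have hqx : ‖q x‖ ≠ 0 := by
      intro h
      rw [h] at hnorm
      simp [hx] at hnorm
    set r : ℝ := ‖q x‖ / ‖t x‖ with hr
    have htx : ‖t x‖ ≠ 0 := norm_ne_zero_iff.mpr hx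
    have hrc : ((r : ℂ) * r) * c = 1 := by
      have h1 : (‖q x‖ : ℂ) ≠ 0 := by exact_mod_cast hqx
      have h2 : (‖t x‖ : ℂ) ≠ 0 := by exact_mod_cast htx
      have h3 : c = (‖t x‖ : ℂ) ^ 2 / (‖q x‖ : ℂ) ^ 2 := by
        rw [hnorm]; field_simp
      rw [h3, hr]
      push_cast
      field_simp
    set v := (r : ℂ) • t with hv
    have hvN : v ∈ M.commutant := smul_mem_vonNeumannAlgebra _ htN
    have hvv : star v * v = q := by
      rw [hv, star_smul, smul_mul_smul_comm, htt, smul_smul]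
      have : star (r : ℂ) = r := Complex.conj_ofReal r
      rw [this, hrc, one_smul]
    have hev0 : e * v = 0 := by rw [hv, mul_smul_comm, het, smul_zero]
    have hwv : ∀ w ∈ J, star w * v = 0 := fun w hw => by
      have h1 := congrArg star (hev w hw)
      rw [star_mul, heP.isSelfAdjoint.star_eq] at h1
      rw [← h1, mul_assoc, hev0, mul_zero]
    have hvw : ∀ w ∈ J, star v * w = 0 := fun w hw => by
      have := congrArg star (hwv w hw)
      rwa [star_mul, star_star, star_zero] at this
    have hins : insert v J ∈ S := by
      refine ⟨?_, ?_⟩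
      · rintro w (rfl | hw)
        · exact ⟨hvN, hvv⟩
        · exact hJS.1 w hw
      · rintro w (rfl | hw) w' (rfl | hw') hne
        · exact absurd rfl hne
        · exact hvw _ hw'
        · exact hwv _ hw
        · exact hJS.2 w hw w' hw' hne
    have hvJ : v ∈ J := hJ.le_of_ge hins (Set.subset_insert _ _) (Set.mem_insert _ _)
    exact hq0 (by rw [← hvv]; exact hwv v hvJ)
  set L : Set (E →L[ℂ] E) := {A | ∃ u ∈ M.commutant, u * q = A} with hL
  set f := (jointRange L).starProjection with hf
  have hfM : f ∈ M := by
    refine mem_of_commute fun T hT => ?_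
    have h : ∀ T ∈ M.commutant, ∀ x ∈ jointRange L, T x ∈ jointRange L := fun T hT =>
      jointRange_invariant fun A hA z => by
        obtain ⟨u, hu, rfl⟩ := hA
        exact apply_mem_jointRange (show T * u * q ∈ L from ⟨T * u, mul_mem hT hu, rfl⟩) z
    exact (starProjection_mul_comm _ (h T hT) (h _ (star_mem hT))).symm
  have hfN : f ∈ M.commutant := by
    refine VonNeumannAlgebra.mem_commutant_iff.mpr fun X hX => ?_
    have h : ∀ X ∈ M, ∀ x ∈ jointRange L, X x ∈ jointRange L := fun X hX =>
      jointRange_invariant fun A hA z => by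
        obtain ⟨u, hu, rfl⟩ := hA
        have : X ((u * q) z) = (u * q) (X z) :=
          DFunLike.congr_fun (mul_comm_of_mem_commutant hX (mul_mem hu hqN)) z
        rw [this]
        exact apply_mem_jointRange (show u * q ∈ L from ⟨u, hu, rfl⟩) _
    exact (starProjection_mul_comm _ (h X hX) (h _ (star_mem hX))).symm
  obtain ⟨c, hc⟩ := hM f hfM hfN
  obtain ⟨x, hx⟩ : ∃ x, q x ≠ 0 := by
    by_contra! h
    exact hq0 (ContinuousLinearMap.ext h)
  have hfq : f (q x) = q x := Submodule.starProjection_eq_self_iff.mpr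
    (apply_mem_jointRange (show q ∈ L from ⟨1, one_mem _, one_mul q⟩) x)
  have hc1 : c = 1 := by
    rw [hc] at hfq
    have h1 : (c - 1) • q x = 0 := by
      rw [sub_smul, one_smul, sub_eq_zero]
      exact hfq
    rcases smul_eq_zero.mp h1 with h | h
    · exact sub_eq_zero.mp h
    · exact absurd h hx
  have hz0 : f z = 0 := by
    have hez : e z = 0 := starProjection_jointRange_eq_zero fun A hA => hz ⟨A, hA⟩
    refine starProjection_jointRange_eq_zero ?_
    rintro _ ⟨u, hu, rfl⟩
    have h1 := congrArg star (hzero u hu)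
    rw [mul_assoc, star_mul, heP.one_sub.isSelfAdjoint.star_eq, star_zero] at h1
    have h2 : star (u * q) ((1 - e) z) = 0 := DFunLike.congr_fun h1 z
    rwa [sub_apply, hez, sub_zero] at h2
  rw [hc, hc1, one_smul] at hz0
  exact hz0

namespace IsUnitColumn

variable {J : Type*} {q : E →L[ℂ] E} {v : J → E →L[ℂ] E}

theorem mul_right (hv : IsUnitColumn q v) (j : J) : v j * q = v j := by
  have hqs := hv.proj.isSelfAdjoint.star_eq
  have hqq := hv.proj.isIdempotentElem.eq
  have h : star (v j * q - v j) * (v j * q - v j) = 0 := by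
    rw [star_sub, star_mul, hqs, sub_mul, mul_sub, mul_sub, mul_assoc q, ← mul_assoc (star (v j)),
      hv.star_mul_self, mul_assoc q, hv.star_mul_self, hqq, hqq]
    simp
  exact sub_eq_zero.mp ((CStarRing.star_mul_self_eq_zero_iff _).mp h)

theorem mul_left (hv : IsUnitColumn q v) (j : J) : q * star (v j) = star (v j) := by
  have := congrArg star (hv.mul_right j)
  rwa [star_mul, hv.proj.isSelfAdjoint.star_eq] at this

theorem eq_of_star_mul (hv : IsUnitColumn q v) {A B : E →L[ℂ] E}
    (h : ∀ j, star (v j) * A = star (v j) * B) : A = B := by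
  refine ContinuousLinearMap.ext fun x => sub_eq_zero.mp (hv.total _ fun j => ?_)
  rw [map_sub, sub_eq_zero]
  exact DFunLike.congr_fun (h j) x

theorem eq_of_mul (hv : IsUnitColumn q v) {A B : E →L[ℂ] E} (h : ∀ j, A * v j = B * v j) :
    A = B := by
  refine star_injective (hv.eq_of_star_mul fun j => ?_)
  rw [← star_mul, ← star_mul, h]

variable [DecidableEq J]

theorem star_mul (hv : IsUnitColumn q v) (i j : J) : star (v i) * v j = if i = j then q else 0 := by
  split_ifs with h
  · rw [h, hv.star_mul_self]
  · exact hv.star_mul_of_ne i j h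

theorem star_mul_sum (hv : IsUnitColumn q v) (F : Finset J) (k : J) (Y : J → E →L[ℂ] E) :
    star (v k) * ∑ h ∈ F, v h * Y h = if k ∈ F then q * Y k else 0 := by
  rw [Finset.mul_sum]
  simp_rw [← mul_assoc, hv.star_mul, ite_mul, zero_mul]
  rw [Finset.sum_ite_eq]

/-- The finite partial sums of the diagonal matrix units. -/
theorem isStarProjection_sum (hv : IsUnitColumn q v) (F : Finset J) :
    IsStarProjection (∑ h ∈ F, v h * star (v h)) := by
  refine ⟨?_, ?_⟩
  · rw [IsIdempotentElem, Finset.sum_mul]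
    refine Finset.sum_congr rfl fun k hk => ?_
    rw [mul_assoc, hv.star_mul_sum, if_pos hk, hv.mul_left]
  · rw [IsSelfAdjoint, star_sum]
    simp

theorem norm_sum_le (hv : IsUnitColumn q v) (F : Finset J) : ‖∑ h ∈ F, v h * star (v h)‖ ≤ 1 :=
  (hv.isStarProjection_sum F).norm_le

theorem sum_norm_sq_le (hv : IsUnitColumn q v) (F : Finset J) (x : E) :
    ∑ h ∈ F, ‖star (v h) x‖ ^ 2 ≤ ‖x‖ ^ 2 := by
  have h1 : ((∑ h ∈ F, ‖star (v h) x‖ ^ 2 : ℝ) : ℂ) = ⟪x, (∑ h ∈ F, v h * star (v h)) x⟫ := by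
    rw [sum_apply, inner_sum]
    push_cast
    refine Finset.sum_congr rfl fun h _ => ?_
    have := inner_star_mul_self (star (v h)) x
    rw [star_star] at this
    exact this.symm
  have h2 : ∑ h ∈ F, ‖star (v h) x‖ ^ 2 = ‖((∑ h ∈ F, ‖star (v h) x‖ ^ 2 : ℝ) : ℂ)‖ := by
    rw [Complex.norm_real, Real.norm_of_nonneg (Finset.sum_nonneg fun i _ => sq_nonneg _)]
  rw [h2, h1]
  calc _ ≤ ‖x‖ * ‖(∑ h ∈ F, v h * star (v h)) x‖ := norm_inner_le_norm _ _
    _ ≤ ‖x‖ * (1 * ‖x‖) := by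
      gcongr
      exact le_of_opNorm_le _ (hv.norm_sum_le F) x
    _ = _ := by ring

theorem norm_sum_apply_sq (hv : IsUnitColumn q v) {F : Finset J} {ξ : J → E}
    (hξ : ∀ i ∈ F, q (ξ i) = ξ i) :
    ‖∑ i ∈ F, v i (ξ i)‖ ^ 2 = ∑ i ∈ F, ‖ξ i‖ ^ 2 := by
  have h4 : ∀ z : E, ⟪z, z⟫ = ((‖z‖ ^ 2 : ℝ) : ℂ) := fun z => by
    rw [inner_self_eq_norm_sq_to_K]; push_cast; rfl
  have : ⟪∑ i ∈ F, v i (ξ i), ∑ i ∈ F, v i (ξ i)⟫ = ∑ i ∈ F, ⟪ξ i, ξ i⟫ := by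
    rw [sum_inner]
    refine Finset.sum_congr rfl fun i hi => ?_
    rw [inner_sum]
    have h : ∀ j ∈ F, ⟪v i (ξ i), v j (ξ j)⟫ = if i = j then ⟪ξ i, ξ i⟫ else 0 := by
      intro j hj
      rw [← adjoint_inner_right, ← star_eq_adjoint, ← mul_apply_eq_comp, hv.star_mul]
      split_ifs with hij
      · subst hij; rw [hξ i hi]
      · simp
    rw [Finset.sum_congr rfl h, Finset.sum_ite_eq, if_pos hi]
  simp only [h4] at this
  exact_mod_cast this

theorem tendsto_sum_apply (hv : IsUnitColumn q v) (x : E) :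
    Tendsto (fun F : Finset J => (∑ h ∈ F, v h * star (v h)) x) atTop (𝓝 x) := by
  have htop : jointRange (Set.range v) = ⊤ := by
    rw [← Submodule.orthogonal_eq_bot_iff, Submodule.eq_bot_iff]
    intro z hz
    refine hv.total z fun j => ext_inner_left ℂ fun w => ?_
    rw [star_eq_adjoint, adjoint_inner_right, inner_zero_right]
    exact (Submodule.mem_orthogonal _ _).mp hz _ (apply_mem_jointRange (Set.mem_range_self j) w)
  have heq : Equicontinuous fun (F : Finset J) (x : E) => (∑ h ∈ F, v h * star (v h)) x := by
    refine LipschitzWith.uniformEquicontinuous _ 1 (fun F => ?_) |>.equicontinuous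
    exact (ContinuousLinearMap.lipschitz _).weaken (by exact_mod_cast hv.norm_sum_le F)
  have hclosed := heq.isClosed_setOfPred_tendsto (l := atTop) (f := fun x => x) continuous_id
  let K : Submodule ℂ E :=
    { carrier := {x | Tendsto (fun F : Finset J => (∑ h ∈ F, v h * star (v h)) x) atTop (𝓝 x)}
      add_mem' := fun {a b} ha hb => by
        simpa only [Set.mem_ofPred_eq, map_add] using Tendsto.add ha hb
      zero_mem' := by simp
      smul_mem' := fun c a ha => by
        simpa only [Set.mem_ofPred_eq, map_smul] using Tendsto.const_smul ha c }
  have hK : jointRange (Set.range v) ≤ K := by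
    refine jointRange_le hclosed ?_
    rintro _ ⟨j, rfl⟩ z
    refine tendsto_const_nhds.congr' ?_
    filter_upwards [eventually_ge_atTop {j}] with F hF
    have hj : j ∈ F := hF (Finset.mem_singleton_self j)
    have : (∑ h ∈ F, v h * star (v h)) * v j = v j := by
      have h1 := congrArg star (hv.star_mul_sum F j fun h => star (v h))
      rw [if_pos hj, hv.mul_left, StarMul.star_mul, star_star,
        (hv.isStarProjection_sum F).isSelfAdjoint.star_eq] at h1
      exact h1
    exact DFunLike.congr_fun this.symm z
  exact hK (htop ▸ Submodule.mem_top)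

end IsUnitColumn

end MatrixUnits

namespace IsUnitColumn

section Amplification

open Filter Topology

variable {E : Type*} [NormedAddCommGroup E] [InnerProductSpace ℂ E] [CompleteSpace E]
  {J : Type*} {q : E →L[ℂ] E} {v : J → E →L[ℂ] E}

theorem sum_norm_mul_norm_le (hv : IsUnitColumn q v) (F : Finset J) (x y : E) :
    ∑ h ∈ F, ‖star (v h) x‖ * ‖star (v h) y‖ ≤ ‖x‖ * ‖y‖ := by
  classical
  refine (Real.sum_mul_le_sqrt_mul_sqrt F _ _).trans ?_
  gcongr
  · exact Real.sqrt_le_iff.mpr ⟨norm_nonneg _, hv.sum_norm_sq_le F x⟩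
  · exact Real.sqrt_le_iff.mpr ⟨norm_nonneg _, hv.sum_norm_sq_le F y⟩

theorem summable_norm_mul_norm (hv : IsUnitColumn q v) (x y : E) :
    Summable fun h => ‖star (v h) x‖ * ‖star (v h) y‖ :=
  summable_of_sum_le (fun _ => by positivity) (fun F => hv.sum_norm_mul_norm_le F x y)

theorem norm_inner_conj_le (Y : E →L[ℂ] E) (x y : E) (h : J) :
    ‖⟪star (v h) y, Y (star (v h) x)⟫‖ ≤ ‖Y‖ * (‖star (v h) x‖ * ‖star (v h) y‖) := by
  refine (norm_inner_le_norm _ _).trans ?_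
  calc _ ≤ ‖star (v h) y‖ * (‖Y‖ * ‖star (v h) x‖) := by gcongr; exact le_opNorm _ _
    _ = _ := by ring

theorem exists_amplification (hv : IsUnitColumn q v) : ∃ Λ : (E →L[ℂ] E) →ₗ[ℂ] (E →L[ℂ] E), ∀ Y y x,
    HasSum (fun h => ⟪star (v h) y, Y (star (v h) x)⟫) ⟪y, Λ Y x⟫ := by
  classical
  let Ψ : Finset J → (E →L[ℂ] E) →ₗ[ℂ] (E →L[ℂ] E) := fun F =>
    ∑ h ∈ F, LinearMap.mulLeftRight ℂ (v h, star (v h))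
  have hΨ : ∀ F Y y x, ⟪y, Ψ F Y x⟫ = ∑ h ∈ F, ⟪star (v h) y, Y (star (v h) x)⟫ := by
    intro F Y y x
    simp only [Ψ, LinearMap.sum_apply, LinearMap.mulLeftRight_apply, sum_apply, inner_sum]
    refine Finset.sum_congr rfl fun h _ => ?_
    rw [star_eq_adjoint, adjoint_inner_left]
    rfl
  obtain ⟨Λ, -, hΛ⟩ := exists_tendsto_inner_map (Ultrafilter.of (atTop : Filter (Finset J))) Ψ
    (C := 1) (fun F Y => norm_le_of_inner_le (by positivity) fun y x => by
      rw [hΨ]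
      refine (_root_.norm_sum_le _ _).trans ?_
      refine (Finset.sum_le_sum fun h _ => norm_inner_conj_le Y x y h).trans ?_
      rw [← Finset.mul_sum]
      calc _ ≤ ‖Y‖ * (‖x‖ * ‖y‖) := by gcongr; exact hv.sum_norm_mul_norm_le F x y
        _ = _ := by ring)
  refine ⟨Λ, fun Y y x => ?_⟩
  have hs : Summable fun h => ⟪star (v h) y, Y (star (v h) x)⟫ :=
    Summable.of_norm_bounded ((hv.summable_norm_mul_norm x y).mul_left ‖Y‖)
      (norm_inner_conj_le Y x y)
  have h1 := hΛ Y y x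
  simp only [hΨ] at h1
  have h2 : Tendsto (fun F : Finset J => ∑ h ∈ F, ⟪star (v h) y, Y (star (v h) x)⟫)
      (Ultrafilter.of (atTop : Filter (Finset J))) (𝓝 (∑' h, ⟪star (v h) y, Y (star (v h) x)⟫)) :=
    hs.hasSum.mono_left (Ultrafilter.of_le _)
  rw [tendsto_nhds_unique h1 h2]
  exact hs.hasSum

/-- The normal amplification `Y ↦ ∑ v h * Y * star (v h)`. -/
def amplification (hv : IsUnitColumn q v) : (E →L[ℂ] E) →ₗ[ℂ] (E →L[ℂ] E) :=
  hv.exists_amplification.choose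

theorem hasSum_amplification (hv : IsUnitColumn q v) (Y : E →L[ℂ] E) (y x : E) :
    HasSum (fun h => ⟪star (v h) y, Y (star (v h) x)⟫) ⟪y, hv.amplification Y x⟫ :=
  hv.exists_amplification.choose_spec Y y x

theorem amplification_mul (hv : IsUnitColumn q v) (Y : E →L[ℂ] E) (k : J) :
    hv.amplification Y * v k = v k * (Y * q) := by
  classical
  refine ContinuousLinearMap.ext fun x => ext_inner_left ℂ fun y => ?_
  have h1 := hv.hasSum_amplification Y y (v k x)
  have h2 : ∀ h, ⟪star (v h) y, Y (star (v h) (v k x))⟫ =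
      if h = k then ⟪star (v k) y, Y (q x)⟫ else 0 := by
    intro h
    rw [← mul_apply_eq_comp (star (v h)), hv.star_mul]
    split_ifs with hh
    · rw [hh]
    · simp
  simp only [h2] at h1
  have h3 := h1.unique (hasSum_ite_eq k _)
  rw [mul_apply_eq_comp, h3, star_eq_adjoint, adjoint_inner_left]
  rfl

theorem star_mul_amplification (hv : IsUnitColumn q v) (Y : E →L[ℂ] E) (k : J) :
    star (v k) * hv.amplification Y = q * Y * star (v k) := by
  classical
  refine ContinuousLinearMap.ext fun x => ext_inner_left ℂ fun y => ?_
  have h1 := hv.hasSum_amplification Y (v k y) x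
  have h2 : ∀ h, ⟪star (v h) (v k y), Y (star (v h) x)⟫ =
      if h = k then ⟪q y, Y (star (v k) x)⟫ else 0 := by
    intro h
    rw [← mul_apply_eq_comp (star (v h)), hv.star_mul]
    split_ifs with hh
    · rw [hh]
    · simp
  simp only [h2] at h1
  have h3 := h1.unique (hasSum_ite_eq k _)
  rw [mul_apply_eq_comp, star_eq_adjoint, adjoint_inner_right, h3, ← adjoint_inner_right,
    ← star_eq_adjoint, hv.proj.isSelfAdjoint.star_eq]
  rfl

variable {M : VonNeumannAlgebra E}

theorem exists_star_mul_mul (hv : IsUnitColumn q v) (hvN : ∀ j, v j ∈ M.commutant)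
    (hcorner : ∀ T ∈ M.commutant, ∃ c : ℂ, q * T * q = c • q) {T : E →L[ℂ] E}
    (hT : T ∈ M.commutant) (h k : J) : ∃ c : ℂ, star (v h) * T * v k = c • q := by
  obtain ⟨c, hc⟩ := hcorner (star (v h) * T * v k)
    (mul_mem (mul_mem (star_mem (hvN h)) hT) (hvN k))
  refine ⟨c, ?_⟩
  rw [← hc]
  calc _ = (q * star (v h)) * T * (v k * q) := by rw [hv.mul_left, hv.mul_right]
    _ = _ := by simp only [mul_assoc]

theorem amplification_mem (hv : IsUnitColumn q v) (hvN : ∀ j, v j ∈ M.commutant)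
    (hcorner : ∀ T ∈ M.commutant, ∃ c : ℂ, q * T * q = c • q) (Y : E →L[ℂ] E) :
    hv.amplification Y ∈ M := by
  refine mem_of_commute fun T hT => hv.eq_of_star_mul fun h => hv.eq_of_mul fun k => ?_
  obtain ⟨c, hc⟩ := hv.exists_star_mul_mul hvN hcorner hT h k
  calc star (v h) * (T * hv.amplification Y) * v k
      = (star (v h) * T) * (hv.amplification Y * v k) := by simp only [mul_assoc]
    _ = (star (v h) * T * v k) * (Y * q) := by rw [amplification_mul]; simp only [mul_assoc]
    _ = (q * Y) * (star (v h) * T * v k) := by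
      rw [hc, smul_mul_assoc, mul_smul_comm]; simp only [mul_assoc]
    _ = (star (v h) * hv.amplification Y) * (T * v k) := by
      rw [star_mul_amplification]; simp only [mul_assoc]
    _ = _ := by simp only [mul_assoc]

theorem amplification_mul_of_mem (hv : IsUnitColumn q v) (hvN : ∀ j, v j ∈ M.commutant)
    {B : E →L[ℂ] E} (hB : B ∈ M) :
    hv.amplification (q * B) = B := by
  refine hv.eq_of_star_mul fun k => ?_
  rw [star_mul_amplification, ← mul_assoc, hv.proj.isIdempotentElem.eq, mul_assoc,
    mul_comm_of_mem_commutant hB (star_mem (hvN k)), ← mul_assoc, hv.mul_left]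

theorem exists_pairing_amplification (hv : IsUnitColumn q v) {ι : Type*} (b : HilbertBasis ι ℂ E)
    {T : E →L[ℂ] E}
    (hT : IsTraceClass T) : ∃ S, IsTraceClass S ∧
      ∀ Y, pairing b (hv.amplification Y) T = pairing b Y S := by
  obtain ⟨x, y, hs, hT⟩ := hT
  have hs' : Summable fun a : ℕ × J => ‖star (v a.2) (x a.1)‖ * ‖star (v a.2) (y a.1)‖ := by
    have h1 : ∀ n, Summable fun h => ‖star (v h) (x n)‖ * ‖star (v h) (y n)‖ :=
      fun n => hv.summable_norm_mul_norm _ _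
    have h2 : ∀ n, ∑' h, ‖star (v h) (x n)‖ * ‖star (v h) (y n)‖ ≤ ‖x n‖ * ‖y n‖ :=
      fun n => Real.tsum_le_of_sum_le (fun _ => by positivity)
        fun F => hv.sum_norm_mul_norm_le F _ _
    have h3 : Summable fun n => ∑' h, ‖star (v h) (x n)‖ * ‖star (v h) (y n)‖ :=
      hs.of_nonneg_of_le (fun n => tsum_nonneg fun _ => by positivity) h2
    exact (summable_prod_of_nonneg fun a => mul_nonneg (norm_nonneg _) (norm_nonneg _)).mpr ⟨h1, h3⟩
  obtain ⟨S, hS, hpS⟩ := exists_isTraceClass b hs'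
  refine ⟨S, hS, fun Y => ?_⟩
  rw [hpS, pairing_eq_tsum b hs hT, (summable_inner_of_nuclear hs' Y).tsum_prod]
  exact tsum_congr fun n => (hv.hasSum_amplification Y _ _).tsum_eq.symm

end Amplification

end IsUnitColumn

section CBAmplification

variable {E : Type*} [NormedAddCommGroup E] [InnerProductSpace ℂ E] [CompleteSpace E]

theorem CBBoundOn.norm_sum_le {M : VonNeumannAlgebra E} {φ : (E →L[ℂ] E) →ₗ[ℂ] (E →L[ℂ] E)} {c : ℝ}
    (hφ : CBBoundOn M φ c) {κ : Type*} [Fintype κ] {A : κ → κ → (E →L[ℂ] E)}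
    (hA : ∀ i j, A i j ∈ M)
    (hA1 : ∀ z w : κ → E, ‖∑ i, ∑ j, ⟪w i, A i j (z j)⟫‖ ≤
      √(∑ i, ‖z i‖ ^ 2) * √(∑ i, ‖w i‖ ^ 2)) (z w : κ → E) :
    ‖∑ i, ∑ j, ⟪w i, φ (A i j) (z j)⟫‖ ≤ c * √(∑ i, ‖z i‖ ^ 2) * √(∑ i, ‖w i‖ ^ 2) := by
  let e := (Fintype.equivFin κ).symm
  have h := hφ _ (fun i j => A (e i) (e j)) (fun i j => hA _ _) (fun z w => by
    have h1 := hA1 (z ∘ e.symm) (w ∘ e.symm)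
    rw [one_mul]
    simp only [← Equiv.sum_comp e, Function.comp_apply, Equiv.symm_apply_apply] at h1
    exact h1) (z ∘ e) (w ∘ e)
  simp only [Function.comp_apply] at h
  rw [Equiv.sum_comp e fun i => ‖z i‖ ^ 2, Equiv.sum_comp e fun i => ‖w i‖ ^ 2,
    Equiv.sum_comp e fun i => ∑ j, ⟪w i, φ (A i (e j)) (z (e j))⟫] at h
  simp only [fun i => Equiv.sum_comp e fun j => ⟪w i, φ (A i j) (z j)⟫] at h
  exact h

end CBAmplification

namespace IsUnitColumn

section MatrixAmplification

variable {E : Type*} [NormedAddCommGroup E] [InnerProductSpace ℂ E] [CompleteSpace E]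
  {J : Type*} {q : E →L[ℂ] E} {v : J → E →L[ℂ] E}

theorem proj_star_apply (hv : IsUnitColumn q v) (h : J) (x : E) : q (star (v h) x) = star (v h) x :=
  DFunLike.congr_fun (hv.mul_left h) x

theorem sum_norm_sq_sum_le (hv : IsUnitColumn q v) {k : ℕ} (F G : Finset J) (z : Fin k × F → E) :
    ∑ h ∈ G, ∑ t, ‖∑ j : F, v j (star (v h) (z (t, j)))‖ ^ 2 ≤ ∑ a, ‖z a‖ ^ 2 := by
  classical
  have h1 : ∀ h t, ‖∑ j : F, v j (star (v h) (z (t, j)))‖ ^ 2 =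
      ∑ j : F, ‖star (v h) (z (t, j))‖ ^ 2 := by
    intro h t
    have := hv.norm_sum_apply_sq (F := F)
      (ξ := fun j => if hj : j ∈ F then star (v h) (z (t, ⟨j, hj⟩)) else 0) (fun j hj => by
        simp only [hj, dif_pos]; exact hv.proj_star_apply _ _)
    rw [← Finset.sum_coe_sort, ← Finset.sum_coe_sort F] at this
    simpa using this
  simp only [h1]
  rw [Finset.sum_comm, Fintype.sum_prod_type]
  refine Finset.sum_le_sum fun t _ => ?_
  rw [Finset.sum_comm]
  exact Finset.sum_le_sum fun j _ => hv.sum_norm_sq_le G _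

theorem norm_sum_amplification_le (hv : IsUnitColumn q v) {k : ℕ}
    {A : Fin k → Fin k → (E →L[ℂ] E)} (hA : matNormLe A 1)
    (F : Finset J) (z w : Fin k × F → E) :
    ‖∑ a, ∑ b, ⟪w a, hv.amplification (star (v a.2) * A a.1 b.1 * v b.2) (z b)⟫‖ ≤
      √(∑ a, ‖z a‖ ^ 2) * √(∑ a, ‖w a‖ ^ 2) := by
  have hs : HasSum (fun h => ∑ a, ∑ b, ⟪star (v h) (w a), (star (v a.2) * A a.1 b.1 * v b.2)
      (star (v h) (z b))⟫)
      (∑ a, ∑ b, ⟪w a, hv.amplification (star (v a.2) * A a.1 b.1 * v b.2) (z b)⟫) := by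
    refine hasSum_sum fun a _ => ?_
    refine hasSum_sum fun b _ => ?_
    exact hv.hasSum_amplification _ _ _
  refine le_of_tendsto hs.norm (Filter.Eventually.of_forall fun G => ?_)
  set Z : J → Fin k → E := fun h t => ∑ j : F, v j (star (v h) (z (t, j))) with hZ
  set W : J → Fin k → E := fun h t => ∑ j : F, v j (star (v h) (w (t, j))) with hW
  have h1 : ∀ h, ∑ a, ∑ b, ⟪star (v h) (w a), (star (v a.2) * A a.1 b.1 * v b.2)
      (star (v h) (z b))⟫ = ∑ s, ∑ t, ⟪W h s, A s t (Z h t)⟫ := by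
    intro h
    simp only [Fintype.sum_prod_type, hW, hZ, map_sum, sum_inner, inner_sum]
    refine Finset.sum_congr rfl fun s _ => ?_
    rw [Finset.sum_comm]
    refine Finset.sum_congr rfl fun t _ => ?_
    rw [Finset.sum_comm]
    refine Finset.sum_congr rfl fun i _ => Finset.sum_congr rfl fun j _ => ?_
    rw [mul_apply_eq_comp, mul_apply_eq_comp, star_eq_adjoint (v j), adjoint_inner_right]
  simp only [h1]
  calc _ ≤ ∑ h ∈ G, √(∑ t, ‖Z h t‖ ^ 2) * √(∑ t, ‖W h t‖ ^ 2) := by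
        refine (_root_.norm_sum_le _ _).trans (Finset.sum_le_sum fun h _ => ?_)
        simpa using hA (Z h) (W h)
    _ ≤ √(∑ h ∈ G, ∑ t, ‖Z h t‖ ^ 2) * √(∑ h ∈ G, ∑ t, ‖W h t‖ ^ 2) :=
      Real.sum_sqrt_mul_sqrt_le G (fun _ => by positivity) (fun _ => by positivity)
    _ ≤ _ := by
      gcongr
      · exact hv.sum_norm_sq_sum_le F G z
      · exact hv.sum_norm_sq_sum_le F G w

/-- The compression to the finite corner `F` of the map `id ⊗ φ`, in matrix units. -/
def cornerMap (hv : IsUnitColumn q v) (φ : (E →L[ℂ] E) →ₗ[ℂ] (E →L[ℂ] E)) (F : Finset J) :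
    (E →L[ℂ] E) →ₗ[ℂ] (E →L[ℂ] E) :=
  ∑ i ∈ F, ∑ j ∈ F, LinearMap.mulLeftRight ℂ (v i, star (v j)) ∘ₗ φ ∘ₗ hv.amplification ∘ₗ
    LinearMap.mulLeftRight ℂ (star (v i), v j)

variable {φ : (E →L[ℂ] E) →ₗ[ℂ] (E →L[ℂ] E)}

theorem cornerMap_apply (hv : IsUnitColumn q v) (F : Finset J) (X : E →L[ℂ] E) :
    hv.cornerMap φ F X =
    ∑ i ∈ F, ∑ j ∈ F, v i * φ (hv.amplification (star (v i) * X * v j)) * star (v j) := by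
  simp [cornerMap, LinearMap.sum_apply]

theorem matNormLe_cornerMap (hv : IsUnitColumn q v) {M : VonNeumannAlgebra E}
    (hvN : ∀ j, v j ∈ M.commutant)
    (hcorner : ∀ T ∈ M.commutant, ∃ c : ℂ, q * T * q = c • q) {c : ℝ} (hc : 0 ≤ c)
    (hφ : CBBoundOn M φ c) (F : Finset J) {k : ℕ} {A : Fin k → Fin k → (E →L[ℂ] E)}
    (hA : matNormLe A 1) : matNormLe (fun i j => hv.cornerMap φ F (A i j)) c := by
  intro z w
  have h1 := hφ.norm_sum_le (κ := Fin k × F)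
    (A := fun a b => hv.amplification (star (v a.2) * A a.1 b.1 * v b.2))
    (fun a b => hv.amplification_mem hvN hcorner _)
    (fun z w => hv.norm_sum_amplification_le hA F z w)
    (fun a => star (v a.2) (z a.1)) (fun a => star (v a.2) (w a.1))
  have h2 : ∀ z : Fin k → E, ∑ a : Fin k × F, ‖star (v a.2) (z a.1)‖ ^ 2 ≤ ∑ t, ‖z t‖ ^ 2 := by
    classical
    intro z
    rw [Fintype.sum_prod_type]
    refine Finset.sum_le_sum fun t _ => ?_
    rw [Finset.sum_coe_sort F fun j => ‖star (v j) (z t)‖ ^ 2]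
    exact hv.sum_norm_sq_le F _
  have h3 : ∑ s, ∑ t, ⟪w s, hv.cornerMap φ F (A s t) (z t)⟫ =
      ∑ a : Fin k × F, ∑ b : Fin k × F, ⟪star (v a.2) (w a.1),
        φ (hv.amplification (star (v a.2) * A a.1 b.1 * v b.2)) (star (v b.2) (z b.1))⟫ := by
    simp only [cornerMap_apply, Fintype.sum_prod_type, sum_apply, inner_sum]
    refine Finset.sum_congr rfl fun s _ => ?_
    rw [Finset.sum_comm' (t' := F) (s' := fun _ => Finset.univ) (by simp), ← Finset.sum_coe_sort F]
    refine Finset.sum_congr rfl fun i _ => Finset.sum_congr rfl fun t _ => ?_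
    rw [← Finset.sum_coe_sort F]
    refine Finset.sum_congr rfl fun j _ => ?_
    rw [star_eq_adjoint (v i), adjoint_inner_left]
    rfl
  rw [h3]
  refine h1.trans ?_
  gcongr
  · exact h2 z
  · exact h2 w

end MatrixAmplification

end IsUnitColumn

section Limit

open Filter Topology

variable {E : Type*} [NormedAddCommGroup E] [InnerProductSpace ℂ E] [CompleteSpace E]

theorem matNormLe_single {X : E →L[ℂ] E} (hX : ‖X‖ ≤ 1) :
    matNormLe (fun _ _ : Fin 1 => X) 1 := by
  intro z w
  simp only [Finset.univ_unique, Finset.sum_singleton, Real.sqrt_sq (norm_nonneg _), one_mul]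
  refine (norm_inner_le_norm _ _).trans ?_
  rw [mul_comm]
  gcongr
  simpa using le_of_opNorm_le _ hX (z default)

theorem norm_le_of_matNormLe {Φ : (E →L[ℂ] E) →ₗ[ℂ] (E →L[ℂ] E)} {c : ℝ} (hc : 0 ≤ c)
    (h : ∀ A : Fin 1 → Fin 1 → (E →L[ℂ] E), matNormLe A 1 →
      matNormLe (fun i j => Φ (A i j)) c) (X : E →L[ℂ] E) : ‖Φ X‖ ≤ c * ‖X‖ := by
  have h1 : ∀ X, ‖X‖ ≤ 1 → ‖Φ X‖ ≤ c := fun X hX => by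
    refine norm_le_of_inner_le hc fun y x => ?_
    have := h _ (matNormLe_single hX) (fun _ => x) (fun _ => y)
    simp only [Finset.univ_unique, Finset.sum_singleton, Real.sqrt_sq (norm_nonneg _)] at this
    linarith
  rcases eq_or_ne X 0 with rfl | hX
  · simp
  have hX' : 0 < ‖X‖ := norm_pos_iff.mpr hX
  have h2 := h1 ((‖X‖⁻¹ : ℂ) • X) (by simp [norm_smul, hX'.ne'])
  rw [map_smul, norm_smul, norm_inv, Complex.norm_real, norm_norm, inv_mul_le_iff₀ hX'] at h2
  linarith

theorem exists_pairing_sum {ι : Type*} (b : HilbertBasis ι ℂ E) {T : E →L[ℂ] E}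
    (hT : IsTraceClass T) {α : Type*} (s : Finset α)
    (f : α → (E →L[ℂ] E) → (E →L[ℂ] E))
    (h : ∀ a, ∃ S, IsTraceClass S ∧ ∀ X, pairing b (f a X) T = pairing b X S) :
    ∃ S, IsTraceClass S ∧ ∀ X, pairing b (∑ a ∈ s, f a X) T = pairing b X S := by
  classical
  induction s using Finset.induction_on with
  | empty => exact ⟨0, (traceClassSubmodule E).zero_mem, fun X => by simp [pairing, tr]⟩
  | insert a s ha ih =>
    obtain ⟨S, hS, hp⟩ := ih
    obtain ⟨S', hS', hp'⟩ := h a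
    refine ⟨S' + S, hS'.add hS, fun X => ?_⟩
    rw [Finset.sum_insert ha, pairing_add_left b hT, hp, hp', pairing_add_right b hS' hS]

namespace IsUnitColumn

variable {J : Type*} {q : E →L[ℂ] E} {v : J → E →L[ℂ] E}
  {φ Φ : (E →L[ℂ] E) →ₗ[ℂ] (E →L[ℂ] E)}

theorem star_mul_cornerMap_mul (hv : IsUnitColumn q v) [DecidableEq J] (F : Finset J)
    (X : E →L[ℂ] E) (k l : J) :
    star (v k) * hv.cornerMap φ F X * v l = if k ∈ F ∧ l ∈ F then
      q * φ (hv.amplification (star (v k) * X * v l)) * q else 0 := by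
  simp only [cornerMap_apply, Finset.mul_sum, Finset.sum_mul]
  have h : ∀ i j, star (v k) * (v i * φ (hv.amplification (star (v i) * X * v j)) * star (v j)) *
      v l = if k = i then (if j = l then
        q * φ (hv.amplification (star (v k) * X * v l)) * q else 0) else 0 := by
    intro i j
    calc _ = (star (v k) * v i) * φ (hv.amplification (star (v i) * X * v j)) *
        (star (v j) * v l) := by simp only [mul_assoc]
      _ = _ := by
        rw [hv.star_mul, hv.star_mul]
        split_ifs with h1 h2
        · rw [h1, h2]
        all_goals simp
  simp only [h]
  by_cases hk : k ∈ F <;> by_cases hl : l ∈ F <;> simp [hk, hl]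

theorem star_mul_sum_self (hv : IsUnitColumn q v) [DecidableEq J] (F : Finset J) (k : J) :
    star (v k) * ∑ h ∈ F, v h * star (v h) = if k ∈ F then star (v k) else 0 := by
  rw [hv.star_mul_sum, hv.mul_left]

theorem sum_mul_self (hv : IsUnitColumn q v) [DecidableEq J] (F : Finset J) (k : J) :
    (∑ h ∈ F, v h * star (v h)) * v k = if k ∈ F then v k else 0 := by
  have := congrArg star (hv.star_mul_sum_self F k)
  rw [StarMul.star_mul, star_star, (hv.isStarProjection_sum F).isSelfAdjoint.star_eq] at this
  rw [this]
  split_ifs <;> simp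

/-- The map `Φ` is a point-weak limit of the corner maps of `φ`. -/
def IsLimitOfCorners (hv : IsUnitColumn q v)
    (φ Φ : (E →L[ℂ] E) →ₗ[ℂ] (E →L[ℂ] E)) : Prop :=
  ∀ X y x, Tendsto (fun F => ⟪y, hv.cornerMap φ F X x⟫)
    (Ultrafilter.of (atTop : Filter (Finset J))) (𝓝 ⟪y, Φ X x⟫)

variable {hv : IsUnitColumn q v}

theorem IsLimitOfCorners.star_mul_mul (hΦ : hv.IsLimitOfCorners φ Φ) (X : E →L[ℂ] E) (k l : J) :
    star (v k) * Φ X * v l = q * φ (hv.amplification (star (v k) * X * v l)) * q := by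
  classical
  refine ContinuousLinearMap.ext fun x => ext_inner_left ℂ fun y => ?_
  have h1 := hΦ X (v k y) (v l x)
  have h2 : ∀ᶠ F in (Ultrafilter.of (atTop : Filter (Finset J)) : Filter (Finset J)),
      ⟪y, (q * φ (hv.amplification (star (v k) * X * v l)) * q) x⟫ =
        ⟪v k y, hv.cornerMap φ F X (v l x)⟫ := by
    refine Ultrafilter.of_le _ ?_
    filter_upwards [eventually_ge_atTop {k, l}] with F hF
    have hkl : k ∈ F ∧ l ∈ F := ⟨hF (by simp), hF (by simp)⟩
    have h3 := hv.star_mul_cornerMap_mul (φ := φ) F X k l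
    rw [if_pos hkl] at h3
    rw [← h3, ← adjoint_inner_right, ← star_eq_adjoint]
    rfl
  have h4 := tendsto_nhds_unique h1 (tendsto_const_nhds.congr' h2)
  rw [← h4, ← adjoint_inner_right, ← star_eq_adjoint]
  rfl

theorem IsLimitOfCorners.cornerMap_eq [DecidableEq J] (hΦ : hv.IsLimitOfCorners φ Φ)
    (F : Finset J) (X : E →L[ℂ] E) :
    Φ ((∑ h ∈ F, v h * star (v h)) * X * (∑ h ∈ F, v h * star (v h))) = hv.cornerMap φ F X := by
  refine hv.eq_of_star_mul fun k => hv.eq_of_mul fun l => ?_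
  rw [hΦ.star_mul_mul, hv.star_mul_cornerMap_mul, ← mul_assoc, ← mul_assoc, hv.star_mul_sum_self,
    mul_assoc _ _ (v l), hv.sum_mul_self]
  by_cases hk : k ∈ F <;> by_cases hl : l ∈ F <;> simp [hk, hl]

theorem IsLimitOfCorners.extendsTilde {M : VonNeumannAlgebra E} (hΦ : hv.IsLimitOfCorners φ Φ)
    (hvN : ∀ j, v j ∈ M.commutant) (hqN : q ∈ M.commutant)
    (hcorner : ∀ T ∈ M.commutant, ∃ c : ℂ, q * T * q = c • q) (hφM : ∀ B ∈ M, φ B ∈ M) :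
    ExtendsTilde M φ Φ := by
  intro A hA B hB
  refine hv.eq_of_star_mul fun k => hv.eq_of_mul fun l => ?_
  obtain ⟨c, hc⟩ := hv.exists_star_mul_mul hvN hcorner hA k l
  have h1 : star (v k) * (A * B) * v l = c • (q * B) := by
    rw [← smul_mul_assoc, ← hc]
    simp only [mul_assoc]
    rw [mul_comm_of_mem_commutant hB (hvN l)]
  have h2 : star (v k) * (A * φ B) * v l = c • (q * φ B) := by
    rw [← smul_mul_assoc, ← hc]
    simp only [mul_assoc]
    rw [mul_comm_of_mem_commutant (hφM B hB) (hvN l)]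
  rw [hΦ.star_mul_mul, h1, h2, map_smul, map_smul, hv.amplification_mul_of_mem hvN hB,
    mul_smul_comm, smul_mul_assoc, mul_assoc, mul_comm_of_mem_commutant (hφM B hB) hqN,
    ← mul_assoc, hv.proj.isIdempotentElem.eq]

theorem IsLimitOfCorners.matNormLe {c : ℝ} (hΦ : hv.IsLimitOfCorners φ Φ) {k : ℕ}
    {A : Fin k → Fin k → (E →L[ℂ] E)}
    (hA : ∀ F, ChoiInf.matNormLe (fun i j => hv.cornerMap φ F (A i j)) c) :
    ChoiInf.matNormLe (fun i j => Φ (A i j)) c := by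
  intro z w
  have h : Tendsto (fun F => ∑ i, ∑ j, ⟪w i, hv.cornerMap φ F (A i j) (z j)⟫)
      (Ultrafilter.of (atTop : Filter (Finset J))) (𝓝 (∑ i, ∑ j, ⟪w i, Φ (A i j) (z j)⟫)) :=
    tendsto_finsetSum _ fun i _ => tendsto_finsetSum _ fun j _ => hΦ _ _ _
  exact le_of_tendsto h.norm (Eventually.of_forall fun F => hA F z w)

theorem exists_pairing_cornerMap {ι : Type*} (b : HilbertBasis ι ℂ E) {M : VonNeumannAlgebra E}
    (hvN : ∀ j, v j ∈ M.commutant)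
    (hcorner : ∀ T ∈ M.commutant, ∃ c : ℂ, q * T * q = c • q) (hφ : NormalOn b M φ)
    (F : Finset J) {T : E →L[ℂ] E} (hT : IsTraceClass T) :
    ∃ S, IsTraceClass S ∧ ∀ X, pairing b (hv.cornerMap φ F X) T = pairing b X S := by
  have h : ∀ i j, ∃ S, IsTraceClass S ∧ ∀ X, pairing b
      (v i * φ (hv.amplification (star (v i) * X * v j)) * star (v j)) T = pairing b X S := by
    intro i j
    obtain ⟨S₁, hS₁, h₁⟩ := hφ (star (v j) * T * v i) ((hT.mul_left _).mul_right _)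
    obtain ⟨S₂, hS₂, h₂⟩ := hv.exists_pairing_amplification b hS₁
    refine ⟨v j * S₂ * star (v i), (hS₂.mul_left _).mul_right _, fun X => ?_⟩
    rw [← pairing_mul_left, ← pairing_mul_right b (hT.mul_left _), h₁ _
      (hv.amplification_mem hvN hcorner _), h₂, pairing_mul_right b (hS₂.mul_left _),
      pairing_mul_left]
  simp only [cornerMap_apply]
  exact exists_pairing_sum b hT F _ fun i => exists_pairing_sum b hT F _ (h i)

theorem IsLimitOfCorners.exists_isNormalPair {ι : Type*} (b : HilbertBasis ι ℂ E)
    {M : VonNeumannAlgebra E} (hΦ : hv.IsLimitOfCorners φ Φ)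
    (hvN : ∀ j, v j ∈ M.commutant)
    (hcorner : ∀ T ∈ M.commutant, ∃ c : ℂ, q * T * q = c • q) (hφ : NormalOn b M φ)
    {c : ℝ} (hc : 0 ≤ c) (hbound : ∀ F X, ‖hv.cornerMap φ F X‖ ≤ c * ‖X‖)
    (hΦc : ∀ X, ‖Φ X‖ ≤ c * ‖X‖) : ∃ Φst, IsNormalPair b Φ Φst := by
  classical
  refine ChoiInf.exists_isNormalPair b Φ fun T hT => ?_
  obtain ⟨x, y, hs, hxy⟩ := id hT
  have hbd : ∀ (A X : E →L[ℂ] E), ‖A‖ ≤ c * ‖X‖ → ∀ n,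
      ‖⟪y n, A (x n)⟫‖ ≤ c * ‖X‖ * (‖x n‖ * ‖y n‖) := by
    intro A X hA n
    refine (norm_inner_le_norm _ _).trans ?_
    calc _ ≤ ‖y n‖ * (c * ‖X‖ * ‖x n‖) := by gcongr; exact le_of_opNorm_le _ hA _
      _ = _ := by ring
  let f : (E →L[ℂ] E) →ₗ[ℂ] ℂ :=
    { toFun := fun X => pairing b (Φ X) T
      map_add' := fun X Y => by rw [map_add, pairing_add_left b hT]
      map_smul' := fun c X => by rw [map_smul, pairing_smul_left]; rfl }
  refine exists_pairing_eq_of_tendsto b (l := Ultrafilter.of (atTop : Filter (Finset J)))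
    (P := fun F => ∑ h ∈ F, v h * star (v h)) (C := c * ∑' n, ‖x n‖ * ‖y n‖)
    (fun F => (hv.isStarProjection_sum F).isSelfAdjoint.star_eq) hv.norm_sum_le
    (fun x => (hv.tendsto_sum_apply x).mono_left (Ultrafilter.of_le _)) f (by positivity)
    (fun X => ?_) (fun X => ?_) (fun F => ?_)
  · change ‖pairing b (Φ X) T‖ ≤ _
    rw [pairing_eq_tsum b hs hxy]
    refine (tsum_of_norm_bounded (hs.hasSum.mul_left _) (hbd _ X (hΦc X))).trans (le_of_eq ?_)
    ring
  · change Tendsto (fun F => pairing b (Φ _) T) _ (𝓝 (pairing b (Φ X) T))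
    simp only [hΦ.cornerMap_eq, pairing_eq_tsum b hs hxy]
    exact tendsto_tsum_of_dominated_convergence (hs.mul_left (c * ‖X‖)) (fun n => hΦ X _ _)
      (Eventually.of_forall fun F n => hbd _ X (hbound F X) n)
  · obtain ⟨S, hS, h⟩ := exists_pairing_cornerMap (hv := hv) b hvN hcorner hφ F hT
    refine ⟨S, hS, fun X => ?_⟩
    change pairing b (Φ _) T = _
    rw [hΦ.cornerMap_eq, h]

end IsUnitColumn

end Limit

theorem exists_tilde_extension {E : Type*} [NormedAddCommGroup E] [InnerProductSpace ℂ E]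
    [CompleteSpace E] {ι : Type*} (b : HilbertBasis ι ℂ E) {M : VonNeumannAlgebra E}
    (hM : IsFactor M) (hI : IsTypeI M) {φ : (E →L[ℂ] E) →ₗ[ℂ] (E →L[ℂ] E)}
    (hφM : ∀ B ∈ M, φ B ∈ M) (hφ : NormalOn b M φ) (hcb : IsCBOn M φ) :
    ∃ Φ Φst : (E →L[ℂ] E) →ₗ[ℂ] (E →L[ℂ] E), ExtendsTilde M φ Φ ∧ IsNormalPair b Φ Φst ∧
      ∃ c, 0 ≤ c ∧ ∀ (k : ℕ) (A : Fin k → Fin k → (E →L[ℂ] E)),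
        matNormLe A 1 → matNormLe (fun i j => Φ (A i j)) c := by
  obtain ⟨p, hp⟩ := hI
  obtain ⟨q, hqN, hq, hq0, hqc⟩ := exists_isStarProjection_commutant hp.1 ⟨hp.2.1, hp.2.2.1⟩
    (fun _ hx => hp.corner hx) hp.2.2.2.1
  obtain ⟨J, hJN, hv⟩ := exists_isUnitColumn hM hqN hq hq0 hqc
  have hvN : ∀ j : J, (j : E →L[ℂ] E) ∈ M.commutant := fun j => hJN _ j.2
  obtain ⟨c, hc, hφc⟩ := hcb
  have hmat : ∀ F (k : ℕ) (A : Fin k → Fin k → (E →L[ℂ] E)), matNormLe A 1 →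
      matNormLe (fun i j => hv.cornerMap φ F (A i j)) c := fun F k A hA =>
    hv.matNormLe_cornerMap hvN hqc hc hφc F hA
  have hbound : ∀ F X, ‖hv.cornerMap φ F X‖ ≤ c * ‖X‖ := fun F =>
    norm_le_of_matNormLe hc (hmat F 1)
  obtain ⟨Φ, hΦc, hΦ⟩ := exists_tendsto_inner_map
    (Ultrafilter.of (Filter.atTop : Filter (Finset J))) (hv.cornerMap φ) hbound
  have hlim : hv.IsLimitOfCorners φ Φ := hΦ
  obtain ⟨Φst, hΦst⟩ := hlim.exists_isNormalPair b hvN hqc hφ hc hbound hΦc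
  exact ⟨Φ, Φst, hlim.extendsTilde hvN hqN hqc hφM, hΦst, c, hc,
    fun k A hA => hlim.matNormLe fun F => hmat F k A hA⟩

/-- Theorem 4.1.  For a factor `M`, the following are
equivalent: (i) for every normal completely bounded `φ : M → M` the map `φ̃`
extends to a normal completely bounded map on `B(H)`; (ii) for every normal
completely bounded `φ : M → M` the map `φ̃` extends to a normal map on `B(H)`;
(iii) `M` is of type I. -/
theorem statement8
    {H : Type*} [NormedAddCommGroup H] [InnerProductSpace ℂ H] [CompleteSpace H]
    [TopologicalSpace.SeparableSpace H]
    {ι : Type*} (b : HilbertBasis ι ℂ H)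
    (M : VonNeumannAlgebra H) (hfactor : IsFactor M)
    (x0 : H) (hx0 : ‖x0‖ = 1) (hcyc : Cyclic M x0) (hsep : Separating M x0) :
    List.TFAE [
      ∀ φ : (H →L[ℂ] H) →ₗ[ℂ] (H →L[ℂ] H), (∀ B ∈ M, φ B ∈ M) →
        NormalOn b M φ → IsCBOn M φ →
        ∃ Φ Φst : (H →L[ℂ] H) →ₗ[ℂ] (H →L[ℂ] H),
          ExtendsTilde M φ Φ ∧ IsNormalPair b Φ Φst ∧
          ∃ c, 0 ≤ c ∧ ∀ (k : ℕ) (A : Fin k → Fin k → (H →L[ℂ] H)),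
            matNormLe A 1 → matNormLe (fun i j => Φ (A i j)) c,
      ∀ φ : (H →L[ℂ] H) →ₗ[ℂ] (H →L[ℂ] H), (∀ B ∈ M, φ B ∈ M) →
        NormalOn b M φ → IsCBOn M φ →
        ∃ Φ Φst : (H →L[ℂ] H) →ₗ[ℂ] (H →L[ℂ] H),
          ExtendsTilde M φ Φ ∧ IsNormalPair b Φ Φst,
      IsTypeI M] := by
  tfae_have 1 → 2 := fun h φ hM hn hc =>
    let ⟨Φ, Φst, h1, h2, _⟩ := h φ hM hn hc
    ⟨Φ, Φst, h1, h2⟩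
  tfae_have 2 → 3 := fun h => by
    obtain ⟨Φ, Φst, h1, h2⟩ := h (vectorStateMap x0) (fun B _ => vectorStateMap_mem M x0 B)
      (normalOn_vectorStateMap b M x0) (isCBOn_vectorStateMap b M hx0)
    have hΦ : IsSliceExtension b M x0 Φ Φst :=
      { factor := hfactor
        norm_eq := hx0
        normal := h2
        ext := fun A' hA' B hB => by
          rw [h1 A' hA' B hB, vectorStateMap_apply, mul_smul_comm, mul_one] }
    exact hΦ.isTypeI hcyc
  tfae_have 3 → 1 := fun hI φ hM hn hc => exists_tilde_extension b hfactor hI hM hn hc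
  tfae_finish

end ChoiInf
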